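/- arXiv:1507.02728 — 4 statements merged into one kernel-verified Lean document; each statement's English description precedes it below -/
import Mathlib

section
/- The square root velocity transform R : W^{1,∞}([0,1],ℝ^d) → L^∞([0,1],ℝ^d), defined by R(c) = V ∘ c', is Hölder continuous with exponent 1/2: there is a constant C such that ‖R(c₁) − R(c₂)‖_{L^∞} ≤ C ‖c₁' − c₂'‖_{L^∞}^{1/2} for all Lipschitz curves c₁, c₂. -/
open MeasureTheory Set Filter
open scoped NNReal ENNReal

noncomputable section

/-- `ℝ^d` with the Euclidean norm. -/
abbrev E (d : ℕ) := EuclideanSpace ℝ (Fin d)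

/-- `V x = x / √|x|`, with `V 0 = 0` (note `Real.sqrt 0 = 0` and `0⁻¹ = 0`). -/
def V {d : ℕ} (x : E d) : E d := (Real.sqrt ‖x‖)⁻¹ • x

/-- `c` is an absolutely continuous curve on `[0,1]` with `c 0 = 0` and a.e. derivative `f`,
i.e. `c t = ∫_0^t f` on `[0,1]` with `f` integrable. -/
def IsACDeriv {d : ℕ} (c f : ℝ → E d) : Prop :=
  StronglyMeasurable f ∧ IntegrableOn f (Icc 0 1) volume ∧
    ∀ t ∈ Icc (0:ℝ) 1, c t = ∫ τ in (0:ℝ)..t, f τ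

/-- Scalar version: `γ t = ∫_0^t g` on `[0,1]` with `g` integrable. -/
def IsACDerivR (γ g : ℝ → ℝ) : Prop :=
  StronglyMeasurable g ∧ IntegrableOn g (Icc 0 1) volume ∧
    ∀ t ∈ Icc (0:ℝ) 1, γ t = ∫ τ in (0:ℝ)..t, g τ

/-- The semigroup `Γ̄` of absolutely continuous `γ : [0,1] → [0,1]` with
`γ 0 = 0`, `γ 1 = 1` and `γ' ≥ 0` a.e. -/
def MemGammaBar (γ : ℝ → ℝ) : Prop :=
  ∃ g, IsACDerivR γ g ∧ (∀ᵐ t ∂(volume.restrict (Icc (0:ℝ) 1)), 0 ≤ g t) ∧ γ 1 = 1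

/-- The group `Γ` of absolutely continuous `γ : [0,1] → [0,1]` with
`γ 0 = 0`, `γ 1 = 1` and `γ' > 0` a.e. -/
def MemGamma (γ : ℝ → ℝ) : Prop :=
  ∃ g, IsACDerivR γ g ∧ (∀ᵐ t ∂(volume.restrict (Icc (0:ℝ) 1)), 0 < g t) ∧ γ 1 = 1

/-- The map `V x = x / √‖x‖` is Hölder continuous with exponent `1/2`, for `‖y‖ ≤ ‖x‖`. -/
lemma norm_V_sub_V_le_of_norm_le {d : ℕ} {x y : E d} (hyx : ‖y‖ ≤ ‖x‖) :
    ‖V x - V y‖ ≤ 3 * √‖x - y‖ := by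
  rcases eq_or_ne x 0 with rfl | hx
  · have hy : y = 0 := by simpa using hyx
    simp [hy]
  have ha : 0 < √‖x‖ := Real.sqrt_pos.2 (norm_pos_iff.2 hx)
  have hb : 0 ≤ √‖y‖ := Real.sqrt_nonneg _
  have he : 0 ≤ √‖x - y‖ := Real.sqrt_nonneg _
  have hba : √‖y‖ ≤ √‖x‖ := Real.sqrt_le_sqrt hyx
  have ha2 : √‖x‖ ^ 2 = ‖x‖ := Real.sq_sqrt (norm_nonneg x)
  have hb2 : √‖y‖ ^ 2 = ‖y‖ := Real.sq_sqrt (norm_nonneg y)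
  have he2 : √‖x - y‖ ^ 2 = ‖x - y‖ := Real.sq_sqrt (norm_nonneg _)
  have h_add : ‖x - y‖ ≤ ‖x‖ + ‖y‖ := norm_sub_le x y
  have h_sub : ‖x‖ - ‖y‖ ≤ ‖x - y‖ := norm_sub_norm_le x y
  have h_split : V x - V y = (√‖x‖)⁻¹ • (x - y) + ((√‖x‖)⁻¹ - (√‖y‖)⁻¹) • y := by
    simp only [V, smul_sub, sub_smul]
    abel
  have h_first : ‖(√‖x‖)⁻¹ • (x - y)‖ ≤ 2 * √‖x - y‖ := by
    have hea : √‖x - y‖ ≤ 2 * √‖x‖ := by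
      apply le_of_sq_le_sq _ (by positivity)
      nlinarith
    rw [norm_smul, norm_inv, Real.norm_of_nonneg ha.le, inv_mul_le_iff₀ ha]
    nlinarith
  have h_second : ‖((√‖x‖)⁻¹ - (√‖y‖)⁻¹) • y‖ ≤ √‖x - y‖ := by
    rcases eq_or_ne y 0 with rfl | hy
    · simp
    have hb' : 0 < √‖y‖ := Real.sqrt_pos.2 (norm_pos_iff.2 hy)
    have hinv : (√‖x‖)⁻¹ ≤ (√‖y‖)⁻¹ := inv_anti₀ hb' hba
    have hab : √‖x‖ - √‖y‖ ≤ √‖x - y‖ := by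
      apply le_of_sq_le_sq _ he
      nlinarith
    have h_eq : ((√‖y‖)⁻¹ - (√‖x‖)⁻¹) * ‖y‖ = √‖y‖ / √‖x‖ * (√‖x‖ - √‖y‖) := by
      nth_rw 2 [← hb2]
      field_simp
    rw [norm_smul, Real.norm_of_nonpos (by linarith), neg_sub]
    calc ((√‖y‖)⁻¹ - (√‖x‖)⁻¹) * ‖y‖ = √‖y‖ / √‖x‖ * (√‖x‖ - √‖y‖) := h_eq
      _ ≤ 1 * (√‖x‖ - √‖y‖) :=
          mul_le_mul_of_nonneg_right ((div_le_one ha).2 hba) (by linarith)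
      _ ≤ √‖x - y‖ := by linarith
  calc ‖V x - V y‖ ≤ 2 * √‖x - y‖ + √‖x - y‖ := by
        rw [h_split]
        exact (norm_add_le _ _).trans (add_le_add h_first h_second)
    _ = 3 * √‖x - y‖ := by ring

/-- The map `V x = x / √‖x‖` is Hölder continuous with exponent `1/2` and constant `3`. -/
lemma norm_V_sub_V_le {d : ℕ} (x y : E d) : ‖V x - V y‖ ≤ 3 * √‖x - y‖ := by
  rcases le_total ‖y‖ ‖x‖ with h | h
  · exact norm_V_sub_V_le_of_norm_le h
  · rw [norm_sub_rev, norm_sub_rev x y]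
    exact norm_V_sub_V_le_of_norm_le h

lemma holderWith_V (d : ℕ) : HolderWith 3 (1 / 2) (V : E d → E d) := by
  intro x y
  rw [edist_eq_enorm_sub, edist_eq_enorm_sub, ← ofReal_norm, ← ofReal_norm,
    ENNReal.ofReal_rpow_of_nonneg (norm_nonneg _) (by positivity)]
  refine (ENNReal.ofReal_le_ofReal (norm_V_sub_V_le x y)).trans_eq ?_
  rw [ENNReal.ofReal_mul (by norm_num), Real.sqrt_eq_rpow]
  simp

/-- the square root velocity transform `R(c) = V ∘ c'` is Hölder continuous with
exponent `1/2` from `W^{1,∞}([0,1],ℝ^d)` to `L^∞([0,1],ℝ^d)`: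
`‖R c₁ - R c₂‖_{L^∞} ≤ C ‖c₁' - c₂'‖_{L^∞}^{1/2}` for all Lipschitz curves `c₁, c₂`. -/
theorem stmt_1 (d : ℕ) :
    ∃ C : ℝ≥0, ∀ (c₁ c₂ : ℝ → E d) (f₁ f₂ : ℝ → E d) (K₁ K₂ : ℝ≥0),
      LipschitzOnWith K₁ c₁ (Icc (0:ℝ) 1) → LipschitzOnWith K₂ c₂ (Icc (0:ℝ) 1) →
      (∀ᵐ t ∂(volume.restrict (Icc (0:ℝ) 1)), HasDerivAt c₁ (f₁ t) t) →
      (∀ᵐ t ∂(volume.restrict (Icc (0:ℝ) 1)), HasDerivAt c₂ (f₂ t) t) →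
      eLpNorm (fun t => V (f₁ t) - V (f₂ t)) ⊤ (volume.restrict (Icc (0:ℝ) 1)) ≤
        C * (eLpNorm (fun t => f₁ t - f₂ t) ⊤ (volume.restrict (Icc (0:ℝ) 1))) ^ ((1:ℝ)/2) := by
  refine ⟨3, fun _ _ f₁ f₂ _ _ _ _ _ _ => ?_⟩
  rw [eLpNorm_exponent_top, eLpNorm_exponent_top]
  refine essSup_le_of_ae_le _ ?_
  filter_upwards [enorm_ae_le_eLpNormEssSup (fun t => f₁ t - f₂ t)
    (volume.restrict (Icc (0:ℝ) 1))] with t ht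
  have h := holderWith_V d (f₁ t) (f₂ t)
  rw [edist_eq_enorm_sub, edist_eq_enorm_sub] at h
  push_cast at h
  simp only [ENNReal.coe_ofNat]
  refine h.trans ?_
  gcongr
end
end

section
/- Let γ_n ∈ Γ̄ and δ_n ∈ Γ be sequences such that ‖γ_n − δ_n‖_{AC} = ∫_0^1 |γ_n' − δ_n'| dt → 0. Then γ_n ∘ δ_n^{-1} → Id in Γ̄, i.e. ∫_0^1 |(γ_n ∘ δ_n^{-1})' − 1| dt → 0, where δ_n^{-1} denotes the inverse homeomorphism of δ_n. -/
open MeasureTheory Set Filter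
open scoped NNReal ENNReal

noncomputable section

namespace IsACDerivR

variable {γ g : ℝ → ℝ}

lemma eq_setIntegral (h : IsACDerivR γ g) {t : ℝ} (ht : t ∈ Icc (0:ℝ) 1) :
    γ t = ∫ τ in Icc 0 t, g τ := by
  rw [h.2.2 t ht, intervalIntegral.integral_of_le ht.1, integral_Icc_eq_integral_Ioc]

lemma monotoneOn (h : IsACDerivR γ g)
    (h0 : ∀ᵐ t ∂(volume.restrict (Icc (0:ℝ) 1)), 0 ≤ g t) : MonotoneOn γ (Icc 0 1) := by
  intro s hs t ht hst
  rw [h.eq_setIntegral hs, h.eq_setIntegral ht]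
  exact setIntegral_mono_set (h.2.1.mono_set (Icc_subset_Icc_right ht.2))
    (ae_restrict_of_ae_restrict_of_subset (Icc_subset_Icc_right ht.2) h0)
    (Icc_subset_Icc_right hst).eventuallyLE

lemma ae_eq {h : ℝ → ℝ} (hg : IsACDerivR γ g) (hh : IsACDerivR γ h) :
    g =ᵐ[volume.restrict (Icc (0:ℝ) 1)] h := by
  have hig : IntervalIntegrable g volume 0 1 :=
    (intervalIntegrable_iff_integrableOn_Icc_of_le zero_le_one).2 hg.2.1
  have hih : IntervalIntegrable h volume 0 1 :=
    (intervalIntegrable_iff_integrableOn_Icc_of_le zero_le_one).2 hh.2.1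
  rw [← restrict_Ioo_eq_restrict_Icc]
  refine (ae_restrict_iff' measurableSet_Ioo).2 ?_
  filter_upwards [hig.ae_hasDerivAt_integral, hih.ae_hasDerivAt_integral] with x hxg hxh hx
  rw [uIcc_of_le zero_le_one] at hxg hxh
  have hxg := hxg (Ioo_subset_Icc_self hx) 0 (left_mem_Icc.2 zero_le_one)
  have hxh := hxh (Ioo_subset_Icc_self hx) 0 (left_mem_Icc.2 zero_le_one)
  refine hxg.unique (hxh.congr_of_eventuallyEq ?_)
  filter_upwards [Ioo_mem_nhds hx.1 hx.2] with y hy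
  rw [← hg.2.2 y (Ioo_subset_Icc_self hy), ← hh.2.2 y (Ioo_subset_Icc_self hy)]

end IsACDerivR

lemma apply_le_iff_of_inverse {δ δinv : ℝ → ℝ} (hmono : MonotoneOn δ (Icc 0 1))
    (hinv : ∀ t ∈ Icc (0:ℝ) 1,
      δinv t ∈ Icc (0:ℝ) 1 ∧ δ (δinv t) = t ∧ δinv (δ t) = t)
    {s t : ℝ} (hs : s ∈ Icc (0:ℝ) 1) (ht : t ∈ Icc (0:ℝ) 1) : δ t ≤ s ↔ t ≤ δinv s := by
  obtain ⟨hs1, hs2, -⟩ := hinv s hs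
  refine ⟨fun h => ?_, fun h => (hmono ht hs1 h).trans_eq hs2⟩
  by_contra! hlt
  have hle := hmono hs1 ht hlt.le
  have heq : δ t = s := le_antisymm h (hs2 ▸ hle)
  rw [← heq, (hinv t ht).2.2] at hlt
  exact lt_irrefl _ hlt

/-- Change of variables: an increasing homeomorphism `δ` of `[0,1]` with density `a` pushes the
measure `a dt` forward to Lebesgue measure. -/
lemma map_withDensity_eq_restrict {δ a δinv : ℝ → ℝ} (hδ : IsACDerivR δ a)
    (h0 : ∀ᵐ t ∂(volume.restrict (Icc (0:ℝ) 1)), 0 ≤ a t) (h1 : δ 1 = 1)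
    (hinv : ∀ t ∈ Icc (0:ℝ) 1,
      δinv t ∈ Icc (0:ℝ) 1 ∧ δ (δinv t) = t ∧ δinv (δ t) = t) :
    ((volume.restrict (Icc (0:ℝ) 1)).withDensity (fun t => ENNReal.ofReal (a t))).map δ =
      volume.restrict (Icc (0:ℝ) 1) := by
  have hmono := hδ.monotoneOn h0
  have hmeas : AEMeasurable δ
      ((volume.restrict (Icc (0:ℝ) 1)).withDensity (fun t => ENNReal.ofReal (a t))) :=
    (aemeasurable_restrict_of_monotoneOn measurableSet_Icc hmono).mono_ac
      (withDensity_absolutelyContinuous _ _)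
  have hδ0 : δ 0 = 0 := by simp [hδ.2.2 0 (by simp)]
  refine (Measure.ext_of_Iic _ _ fun s => ?_).symm
  rw [Measure.map_apply_of_aemeasurable hmeas measurableSet_Iic, withDensity_apply',
    Measure.restrict_restrict' measurableSet_Icc, Measure.restrict_apply measurableSet_Iic]
  rcases lt_or_ge s 0 with hs | hs
  · have e1 : Iic s ∩ Icc 0 1 = ∅ := by
      ext t; simp only [mem_inter_iff, mem_Iic, mem_Icc, mem_empty_iff_false]; grind
    have e2 : δ ⁻¹' Iic s ∩ Icc 0 1 = ∅ := by
      refine eq_empty_of_forall_notMem fun t ht => ?_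
      have h2 := hmono (left_mem_Icc.2 zero_le_one) ht.2 ht.2.1
      have h3 : δ t ≤ s := ht.1
      linarith
    simp [e1, e2]
  · have hs' : min s 1 ∈ Icc (0:ℝ) 1 := ⟨le_min hs zero_le_one, min_le_right _ _⟩
    obtain ⟨hi1, hi2, -⟩ := hinv _ hs'
    have e1 : Iic s ∩ Icc 0 1 = Icc 0 (min s 1) := by
      ext t; simp only [mem_inter_iff, mem_Iic, mem_Icc]; grind
    have e2 : δ ⁻¹' Iic s ∩ Icc 0 1 = Icc 0 (δinv (min s 1)) := by
      ext t
      have key : t ∈ Icc (0:ℝ) 1 → (δ t ≤ s ↔ t ≤ δinv (min s 1)) := fun ht => by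
        rw [← apply_le_iff_of_inverse hmono hinv hs' ht, le_min_iff]
        exact ⟨fun h => ⟨h, h1 ▸ hmono ht (right_mem_Icc.2 zero_le_one) ht.2⟩, fun h => h.1⟩
      constructor
      · exact fun h => ⟨h.2.1, (key h.2).1 h.1⟩
      · exact fun h => ⟨(key ⟨h.1, h.2.trans hi1.2⟩).2 h.2, h.1, h.2.trans hi1.2⟩
    have hsub : Icc 0 (δinv (min s 1)) ⊆ Icc 0 1 := Icc_subset_Icc_right hi1.2
    rw [e1, e2, ← ofReal_integral_eq_lintegral_ofReal (hδ.2.1.mono_set hsub)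
      (ae_restrict_of_ae_restrict_of_subset hsub h0), ← hδ.eq_setIntegral hi1, hi2,
      Real.volume_Icc, sub_zero]

/-- The derivative of `γ ∘ δ⁻¹` exists, is nonnegative, and its `L¹` distance to `1` is the `L¹`
distance of the derivatives of `γ` and `δ`. -/
lemma exists_isACDerivR_comp_inverse {γ g δ a δinv : ℝ → ℝ} (hγ : IsACDerivR γ g)
    (hg0 : ∀ᵐ t ∂(volume.restrict (Icc (0:ℝ) 1)), 0 ≤ g t) (hδ : IsACDerivR δ a)
    (ha0 : ∀ᵐ t ∂(volume.restrict (Icc (0:ℝ) 1)), 0 < a t) (h1 : δ 1 = 1)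
    (hinv : ∀ t ∈ Icc (0:ℝ) 1,
      δinv t ∈ Icc (0:ℝ) 1 ∧ δ (δinv t) = t ∧ δinv (δ t) = t) :
    ∃ h, IsACDerivR (γ ∘ δinv) h ∧ (∀ᵐ t ∂(volume.restrict (Icc (0:ℝ) 1)), 0 ≤ h t) ∧
      ∫ t in (0:ℝ)..1, |h t - 1| = ∫ t in (0:ℝ)..1, |g t - a t| := by
  have ha0' : ∀ᵐ t ∂(volume.restrict (Icc (0:ℝ) 1)), 0 ≤ a t := ha0.mono fun t ht => ht.le
  have hmono := hδ.monotoneOn ha0'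
  have hmap := map_withDensity_eq_restrict hδ ha0' h1 hinv
  have hδ0 : δ 0 = 0 := by simp [hδ.2.2 0 (by simp)]
  have hδmem : ∀ t ∈ Icc (0:ℝ) 1, δ t ∈ Icc (0:ℝ) 1 := fun t ht =>
    ⟨hδ0 ▸ hmono (left_mem_Icc.2 zero_le_one) ht ht.1,
      h1 ▸ hmono ht (right_mem_Icc.2 zero_le_one) ht.2⟩
  set ν := volume.restrict (Icc (0:ℝ) 1) with hν
  set μ := ν.withDensity (fun t => ENNReal.ofReal (a t)) with hμ
  have hmeas : AEMeasurable δ μ :=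
    (aemeasurable_restrict_of_monotoneOn measurableSet_Icc hmono).mono_ac
      (withDensity_absolutelyContinuous _ _)
  have hdens : Measurable fun t => ENNReal.ofReal (a t) := hδ.1.measurable.ennreal_ofReal
  have hmem : ∀ᵐ t ∂ν, t ∈ Icc (0:ℝ) 1 := ae_restrict_mem measurableSet_Icc
  have integral_eq : ∀ F : ℝ → ℝ, Measurable F → ∫ s, F s ∂ν = ∫ t, a t * F (δ t) ∂ν := by
    intro F hF
    rw [← hmap, integral_map hmeas hF.aestronglyMeasurable, hμ,
      integral_withDensity_eq_integral_toReal_smul hdens (by simp), hmap]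
    refine integral_congr_ae (ha0'.mono fun t ht => ?_)
    simp [ENNReal.toReal_ofReal ht]
  let I : ℝ → ℝ := IccExtend (zero_le_one (α := ℝ)) fun t => δinv t
  have hI : ∀ t ∈ Icc (0:ℝ) 1, I t = δinv t := fun t ht => IccExtend_of_mem _ _ ht
  have hImono : Monotone I := by
    refine Monotone.IccExtend _ fun s t hst => ?_
    refine (apply_le_iff_of_inverse hmono hinv t.2 (hinv s s.2).1).1 ?_
    rw [(hinv s s.2).2.1]
    exact hst
  have hIδ : ∀ t ∈ Icc (0:ℝ) 1, I (δ t) = t := fun t ht => by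
    rw [hI _ (hδmem t ht), (hinv t ht).2.2]
  let h : ℝ → ℝ := fun s => g (I s) / a (I s)
  have hh : Measurable h := (hγ.1.measurable.div hδ.1.measurable).comp hImono.measurable
  have hcomp : ∀ t ∈ Icc (0:ℝ) 1, h (δ t) = g t / a t := fun t ht => by
    simp only [h, hIδ t ht]
  have hint : Integrable h ν := by
    rw [← hmap, integrable_map_measure hh.aestronglyMeasurable hmeas, hμ,
      integrable_withDensity_iff_integrable_smul' hdens (by simp)]
    refine Integrable.congr hγ.2.1 ?_
    filter_upwards [ha0, hmem] with t ht htm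
    simp only [Function.comp, hcomp t htm, ENNReal.toReal_ofReal ht.le, smul_eq_mul]
    field_simp
  refine ⟨h, ⟨hh.stronglyMeasurable, hint, fun s hs => ?_⟩, ?_, ?_⟩
  · have hi1 := (hinv s hs).1
    have e : ∀ u ∈ Icc (0:ℝ) 1, ∀ F : ℝ → ℝ,
        ∫ τ in Icc 0 u, F τ = ∫ τ, (Iic u).indicator F τ ∂ν := fun u hu F => by
      rw [integral_indicator measurableSet_Iic, hν, Measure.restrict_restrict measurableSet_Iic]
      congr 2
      ext t; simp only [mem_inter_iff, mem_Iic, mem_Icc]; grind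
    rw [intervalIntegral.integral_of_le hs.1, ← integral_Icc_eq_integral_Ioc, e s hs,
      integral_eq _ (hh.indicator measurableSet_Iic), Function.comp, hγ.eq_setIntegral hi1,
      e _ hi1]
    refine integral_congr_ae ?_
    filter_upwards [ha0, hmem] with t ht htm
    have hiff := apply_le_iff_of_inverse hmono hinv hs htm
    simp only [indicator_apply, mem_Iic, hiff, hcomp t htm]
    split_ifs
    · field_simp
    · simp
  · rw [← hmap]
    refine (ae_map_iff hmeas (measurableSet_le measurable_const hh)).2 ?_
    refine (withDensity_absolutelyContinuous _ _).ae_le ?_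
    filter_upwards [ha0, hg0, hmem] with t ht hgt htm
    rw [hcomp t htm]
    positivity
  · rw [intervalIntegral.integral_of_le zero_le_one, intervalIntegral.integral_of_le zero_le_one,
      ← integral_Icc_eq_integral_Ioc, ← integral_Icc_eq_integral_Ioc,
      integral_eq _ (hh.sub_const 1).abs]
    refine integral_congr_ae ?_
    filter_upwards [ha0, hmem] with t ht htm
    rw [hcomp t htm, ← abs_of_pos ht, ← abs_mul, abs_of_pos ht]
    congr 1
    field_simp

/-- if `γₙ ∈ Γ̄`, `δₙ ∈ Γ` and `‖γₙ - δₙ‖_{AC} = ∫_0^1 |γₙ' - δₙ'| → 0`, then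
`γₙ ∘ δₙ⁻¹ → Id` in `Γ̄`, i.e. `γₙ ∘ δₙ⁻¹ ∈ Γ̄` and `∫_0^1 |(γₙ ∘ δₙ⁻¹)' - 1| → 0`, where
`δₙ⁻¹` denotes the inverse homeomorphism of `δₙ` on `[0,1]`. -/
theorem stmt_7 (γ δ δinv : ℕ → ℝ → ℝ) (g dd : ℕ → ℝ → ℝ)
    (hγ : ∀ n, IsACDerivR (γ n) (g n))
    (hγ0 : ∀ n, ∀ᵐ t ∂(volume.restrict (Icc (0:ℝ) 1)), 0 ≤ g n t)
    (hγ1 : ∀ n, γ n 1 = 1)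
    (hδ : ∀ n, IsACDerivR (δ n) (dd n))
    (hδ0 : ∀ n, ∀ᵐ t ∂(volume.restrict (Icc (0:ℝ) 1)), 0 < dd n t)
    (hδ1 : ∀ n, δ n 1 = 1)
    (hinv : ∀ n, ∀ t ∈ Icc (0:ℝ) 1,
      δinv n t ∈ Icc (0:ℝ) 1 ∧ δ n (δinv n t) = t ∧ δinv n (δ n t) = t)
    (hconv : Tendsto (fun n => ∫ t in (0:ℝ)..1, |g n t - dd n t|) atTop (nhds 0)) :
    (∀ n, MemGammaBar (γ n ∘ δinv n)) ∧
    ∀ h : ℕ → ℝ → ℝ, (∀ n, IsACDerivR (γ n ∘ δinv n) (h n)) →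
      Tendsto (fun n => ∫ t in (0:ℝ)..1, |h n t - 1|) atTop (nhds 0) := by
  choose k hk hk0 hk1 using fun n =>
    exists_isACDerivR_comp_inverse (hγ n) (hγ0 n) (hδ n) (hδ0 n) (hδ1 n) (hinv n)
  refine ⟨fun n => ⟨k n, hk n, hk0 n, ?_⟩, fun h hh => hconv.congr fun n => ?_⟩
  · have h1 := (hinv n 1 (right_mem_Icc.2 zero_le_one)).2.2
    rw [hδ1 n] at h1
    rw [Function.comp, h1, hγ1 n]
  · rw [← hk1 n, intervalIntegral.integral_of_le zero_le_one,
      intervalIntegral.integral_of_le zero_le_one, ← integral_Icc_eq_integral_Ioc,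
      ← integral_Icc_eq_integral_Ioc]
    refine integral_congr_ae (((hk n).ae_eq (hh n)).mono fun t ht => ?_)
    simp only [ht]
end
end

section
/- Let c ∈ AC_0([0,1],ℝ^d) be a curve with c' ≠ 0 almost everywhere. Then the orbit c ∘ Γ̄ = { c ∘ γ : γ ∈ Γ̄ } is a closed subset of AC_0([0,1],ℝ^d) with respect to the AC norm. -/
open MeasureTheory Set Filter
open scoped NNReal ENNReal

noncomputable section

/-- The AC norm `‖x‖_{AC} = ∫_0^1 ‖x'‖` of a curve `x ∈ AC₀([0,1],ℝ^d)` (and `0` if `x` is not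
such a curve); well defined since the a.e. derivative is a.e. unique. -/
def ACnorm {d : ℕ} (x : ℝ → E d) : ℝ := by
  classical exact if h : ∃ f, IsACDeriv x f then ∫ t in (0:ℝ)..1, ‖h.choose t‖ else 0

/-- The orbit `c ∘ Γ̄` of a curve under the reparametrisation semigroup `Γ̄`
(curves are compared on `[0,1]`). -/
def OrbitBar {d : ℕ} (c : ℝ → E d) : Set (ℝ → E d) :=
  {x | ∃ γ, MemGammaBar γ ∧ ∀ t ∈ Icc (0:ℝ) 1, x t = c (γ t)}

/-- The orbit `c ∘ Γ` of a curve under the reparametrisation group `Γ`. -/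
def Orbit {d : ℕ} (c : ℝ → E d) : Set (ℝ → E d) :=
  {x | ∃ γ, MemGamma γ ∧ ∀ t ∈ Icc (0:ℝ) 1, x t = c (γ t)}

/-- The closure of a set of curves inside `AC₀([0,1],ℝ^d)` with respect to the AC norm. -/
def ACClosure {d : ℕ} (S : Set (ℝ → E d)) : Set (ℝ → E d) :=
  {x | (∃ f, IsACDeriv x f) ∧ ∀ ε > (0:ℝ), ∃ y ∈ S, ACnorm (x - y) < ε}

lemma withDensity_restrict_apply_eq_ofReal_integral {p : ℝ → ℝ} (hp0 : ∀ x, 0 ≤ p x) {T t : ℝ}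
    (hp : IntegrableOn p (Icc 0 T)) (ht : t ∈ Icc 0 T) {A : Set ℝ} (hA : MeasurableSet A)
    (h : A ∩ Ioc 0 T = Ioc 0 t) :
    ((volume.restrict (Ioc 0 T)).withDensity fun x => ENNReal.ofReal (p x)) A
      = ENNReal.ofReal (∫ τ in (0:ℝ)..t, p τ) := by
  have hi : IntegrableOn p (Ioc 0 t) :=
    hp.mono_set (Ioc_subset_Icc_self.trans (Icc_subset_Icc_right ht.2))
  rw [withDensity_apply _ hA, Measure.restrict_restrict hA, h,
    intervalIntegral.integral_of_le ht.1,
    ofReal_integral_eq_lintegral_ofReal hi (ae_of_all _ hp0)]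

lemma intervalIntegrable_of_subset {F : Type*} [NormedAddCommGroup F] {p : ℝ → F} {T a b : ℝ}
    (hp : IntegrableOn p (Icc 0 T)) (ha : a ∈ Icc 0 T) (hb : b ∈ Icc 0 T) :
    IntervalIntegrable p volume a b :=
  (hp.mono_set (ordConnected_Icc.uIcc_subset ha hb)).intervalIntegrable

lemma monotoneOn_integral {p : ℝ → ℝ} (hp0 : ∀ x, 0 ≤ p x) {T : ℝ}
    (hp : IntegrableOn p (Icc 0 T)) :
    MonotoneOn (fun t => ∫ τ in (0:ℝ)..t, p τ) (Icc 0 T) := by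
  intro a ha b hb hab
  have h0 : (0:ℝ) ∈ Icc 0 T := ⟨le_rfl, ha.1.trans ha.2⟩
  have := intervalIntegral.integral_interval_sub_left
    (intervalIntegrable_of_subset hp h0 hb) (intervalIntegrable_of_subset hp h0 ha)
  have h2 : 0 ≤ ∫ τ in a..b, p τ := intervalIntegral.integral_nonneg hab fun x _ => hp0 x
  dsimp only
  linarith

/-- If the primitives of `p` and `q` are intertwined by `γ`, then `γ` pushes the measure `p dt` on
`[0,T]` forward to the measure `q ds` on `[0,S]`. -/
theorem map_withDensity_eq_of_integral_eq {p q γ : ℝ → ℝ} {T S : ℝ} (hT : 0 ≤ T)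
    (hp0 : ∀ x, 0 ≤ p x) (hq0 : ∀ x, 0 ≤ q x)
    (hp : IntegrableOn p (Icc 0 T)) (hq : IntegrableOn q (Icc 0 S))
    (hγ : Measurable γ) (hmem : ∀ t ∈ Icc 0 T, γ t ∈ Icc 0 S)
    (heq : ∀ t ∈ Icc 0 T, ∫ σ in (0:ℝ)..γ t, q σ = ∫ τ in (0:ℝ)..t, p τ)
    (hmono : StrictMonoOn (fun s => ∫ σ in (0:ℝ)..s, q σ) (Icc 0 S)) (hTS : γ T = S) :
    ((volume.restrict (Ioc 0 T)).withDensity fun x => ENNReal.ofReal (p x)).map γ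
      = (volume.restrict (Ioc 0 S)).withDensity fun x => ENNReal.ofReal (q x) := by
  have hTm : T ∈ Icc 0 T := ⟨hT, le_rfl⟩
  have h0m : (0:ℝ) ∈ Icc 0 T := ⟨le_rfl, hT⟩
  have hS : 0 ≤ S := (hmem T hTm).1.trans (hmem T hTm).2
  have hfin : IsFiniteMeasure
      ((volume.restrict (Ioc 0 T)).withDensity fun x => ENNReal.ofReal (p x)) :=
    isFiniteMeasure_withDensity_ofReal (hp.mono_set Ioc_subset_Icc_self).2
  refine Measure.ext_of_Iic _ _ fun s => ?_
  rw [Measure.map_apply hγ measurableSet_Iic]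
  rcases lt_or_ge s 0 with hs | hs
  · rw [withDensity_restrict_apply_eq_ofReal_integral hp0 hp h0m (hγ measurableSet_Iic),
      withDensity_restrict_apply_eq_ofReal_integral hq0 hq ⟨le_rfl, hS⟩ measurableSet_Iic]
    · simp
    · ext x
      simp only [mem_inter_iff, mem_Iic, mem_Ioc]
      constructor
      · rintro ⟨h1, h2, -⟩; linarith
      · rintro ⟨h1, h2⟩; linarith
    · ext x
      simp only [mem_inter_iff, mem_preimage, mem_Iic, mem_Ioc]
      constructor
      · rintro ⟨h1, h2, h3⟩
        linarith [(hmem x ⟨h2.le, h3⟩).1]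
      · rintro ⟨h1, h2⟩; linarith
  · have hs' : min s S ∈ Icc 0 S := ⟨le_min hs hS, min_le_right _ _⟩
    have hmp := monotoneOn_integral hp0 hp
    have hcont : ContinuousOn (fun t => ∫ τ in (0:ℝ)..t, p τ) (Icc 0 T) := by
      have := intervalIntegral.continuousOn_primitive_interval (μ := volume) (f := p) (a := 0)
        (b := T) (by rwa [uIcc_of_le hT])
      rwa [uIcc_of_le hT] at this
    obtain ⟨t₁, ht₁, hlt₁⟩ : ∃ t ∈ Icc 0 T,
        ∫ τ in (0:ℝ)..t, p τ = ∫ σ in (0:ℝ)..min s S, q σ := by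
      refine intermediate_value_Icc hT hcont ⟨?_, ?_⟩
      · simpa using intervalIntegral.integral_nonneg hs'.1 fun x _ => hq0 x
      · have := hmono.monotoneOn hs' ⟨hS, le_rfl⟩ hs'.2
        rwa [← heq T hTm, hTS]
    have hcl : IsCompact {t ∈ Icc 0 T |
        ∫ τ in (0:ℝ)..t, p τ ≤ ∫ σ in (0:ℝ)..min s S, q σ} := by
      exact isCompact_Icc.of_isClosed_subset
        (hcont.preimage_isClosed_of_isClosed isClosed_Icc isClosed_Iic) fun x hx => hx.1
    obtain ⟨t₀, ⟨ht₀, hlt₀⟩, hmax⟩ := hcl.exists_isGreatest ⟨t₁, ht₁, hlt₁.le⟩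
    have ht₁₀ : t₁ ≤ t₀ := hmax ⟨ht₁, hlt₁.le⟩
    have hval : ∫ τ in (0:ℝ)..t₀, p τ = ∫ σ in (0:ℝ)..min s S, q σ :=
      hlt₀.antisymm (hlt₁ ▸ hmp ht₁ ht₀ ht₁₀)
    rw [withDensity_restrict_apply_eq_ofReal_integral hp0 hp ht₀ (hγ measurableSet_Iic),
      withDensity_restrict_apply_eq_ofReal_integral hq0 hq hs' measurableSet_Iic, hval]
    · ext x
      simp only [mem_inter_iff, mem_Iic, mem_Ioc, le_min_iff]
      tauto
    · ext x
      simp only [mem_inter_iff, mem_preimage, mem_Iic, mem_Ioc]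
      constructor
      · rintro ⟨h1, h2, h3⟩
        have hx : x ∈ Icc 0 T := ⟨h2.le, h3⟩
        refine ⟨h2, hmax ⟨hx, ?_⟩⟩
        rw [← heq x hx]
        exact hmono.monotoneOn (hmem x hx) hs' (le_min h1 (hmem x hx).2)
      · rintro ⟨h1, h2⟩
        have hx : x ∈ Icc 0 T := ⟨h1.le, h2.trans ht₀.2⟩
        refine ⟨?_, h1, hx.2⟩
        refine le_trans ?_ (min_le_left s S)
        rw [← hmono.le_iff_le (hmem x hx) hs']
        rw [heq x hx, ← hval]
        exact hmp hx ht₀ h2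

lemma ae_eq_of_integral_eq {F : Type*} [NormedAddCommGroup F] [NormedSpace ℝ F] [CompleteSpace F]
    {k k' : ℝ → F} (hk : IntegrableOn k (Icc 0 1)) (hk' : IntegrableOn k' (Icc 0 1))
    (h : ∀ t ∈ Icc (0:ℝ) 1, ∫ τ in (0:ℝ)..t, k τ = ∫ τ in (0:ℝ)..t, k' τ) :
    ∀ᵐ t, t ∈ Ioo (0:ℝ) 1 → k t = k' t := by
  have h0 : (0:ℝ) ∈ Icc (0:ℝ) 1 := by simp
  have h1 : (1:ℝ) ∈ Icc (0:ℝ) 1 := by simp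
  filter_upwards [(intervalIntegrable_of_subset hk h0 h1).ae_hasDerivAt_integral,
    (intervalIntegrable_of_subset hk' h0 h1).ae_hasDerivAt_integral] with t ht ht' htm
  have htu : t ∈ uIcc (0:ℝ) 1 := by
    rw [uIcc_of_le zero_le_one]; exact Ioo_subset_Icc_self htm
  have h0u : (0:ℝ) ∈ uIcc (0:ℝ) 1 := by simp
  refine (ht htu 0 h0u).unique ((ht' htu 0 h0u).congr_of_eventuallyEq ?_)
  filter_upwards [Ioo_mem_nhds htm.1 htm.2] with s hs using h s (Ioo_subset_Icc_self hs)

lemma monotone_comp_projIcc {F : ℝ → ℝ} (hF : MonotoneOn F (Icc 0 1)) :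
    Monotone fun t => F (projIcc (0:ℝ) 1 zero_le_one t) := fun _ _ hab =>
  hF (projIcc _ _ _ _).2 (projIcc _ _ _ _).2 (monotone_projIcc _ hab)

/-- A reparametrisation has, up to changing it outside `[0,1]`, a measurable representative with
an everywhere nonnegative derivative. -/
lemma MemGammaBar.exists_measurable {γ : ℝ → ℝ} (hγ : MemGammaBar γ) :
    ∃ γ' g : ℝ → ℝ, Measurable γ' ∧ StronglyMeasurable g ∧ (∀ x, 0 ≤ g x) ∧
      IntegrableOn g (Icc 0 1) ∧ (∀ t ∈ Icc (0:ℝ) 1, γ' t = ∫ τ in (0:ℝ)..t, g τ) ∧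
      ∀ t ∈ Icc (0:ℝ) 1, γ t = γ' t := by
  obtain ⟨g, ⟨hgm, hgi, hγg⟩, hg0, -⟩ := hγ
  have hpos : ∀ᵐ t ∂(volume.restrict (Icc (0:ℝ) 1)), g t = max (g t) 0 := by
    filter_upwards [hg0] with t ht using (max_eq_left ht).symm
  have hi : IntegrableOn (fun t => max (g t) 0) (Icc 0 1) := hgi.congr hpos
  have h0 : ∀ x, 0 ≤ max (g x) 0 := fun x => le_max_right _ _
  have hval : ∀ t ∈ Icc (0:ℝ) 1, (projIcc (0:ℝ) 1 zero_le_one t : ℝ) = t := fun t ht => by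
    rw [projIcc_of_mem _ ht]
  refine ⟨_, fun t => max (g t) 0, (monotone_comp_projIcc (monotoneOn_integral h0 hi)).measurable,
    hgm.sup stronglyMeasurable_const, h0, hi, fun t ht => by simp only [hval t ht],
    fun t ht => ?_⟩
  simp only [hval t ht]
  rw [hγg t ht]
  refine intervalIntegral.integral_congr_ae_restrict ?_
  rw [uIoc_of_le ht.1]
  exact ae_mono (Measure.restrict_mono
    (Ioc_subset_Icc_self.trans (Icc_subset_Icc_right ht.2)) le_rfl) hpos

lemma map_withDensity_eq_restrict_s10 {γ g : ℝ → ℝ} (hγ : Measurable γ) (hg0 : ∀ x, 0 ≤ g x)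
    (hgi : IntegrableOn g (Icc 0 1)) (hγg : ∀ t ∈ Icc (0:ℝ) 1, γ t = ∫ τ in (0:ℝ)..t, g τ)
    {t : ℝ} (ht : t ∈ Icc (0:ℝ) 1) :
    ((volume.restrict (Ioc 0 t)).withDensity fun x => ENNReal.ofReal (g x)).map γ
      = volume.restrict (Ioc 0 (γ t)) := by
  have hsub : Icc 0 t ⊆ Icc 0 1 := Icc_subset_Icc_right ht.2
  have hm := monotoneOn_integral hg0 hgi
  have h := map_withDensity_eq_of_integral_eq (p := g) (q := fun _ => 1) (γ := γ) ht.1 hg0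
    (fun _ => zero_le_one) (hgi.mono_set hsub) (S := γ t) (by simp) hγ
    (fun s hs => ?_) (fun s hs => by simpa using hγg s (hsub hs)) ?_ rfl
  · rw [h]
    simp
  · rw [hγg s (hsub hs), hγg t ht]
    exact ⟨intervalIntegral.integral_nonneg hs.1 fun x _ => hg0 x, hm (hsub hs) ht hs.2⟩
  · intro a _ b _ hab
    simpa using hab

lemma integrableOn_smul_comp {F : Type*} [NormedAddCommGroup F] [NormedSpace ℝ F]
    {γ g : ℝ → ℝ} (hγ : Measurable γ) (hgm : StronglyMeasurable g) (hg0 : ∀ x, 0 ≤ g x)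
    (hgi : IntegrableOn g (Icc 0 1)) (hγg : ∀ t ∈ Icc (0:ℝ) 1, γ t = ∫ τ in (0:ℝ)..t, g τ)
    {t : ℝ} (ht : t ∈ Icc (0:ℝ) 1) {φ : ℝ → F} (hφm : StronglyMeasurable φ)
    (hφ : IntegrableOn φ (Ioc 0 (γ t))) :
    IntegrableOn (fun τ => g τ • φ (γ τ)) (Ioc 0 t) := by
  rw [IntegrableOn, ← map_withDensity_eq_restrict_s10 hγ hg0 hgi hγg ht,
    integrable_map_measure hφm.aestronglyMeasurable hγ.aemeasurable,
    integrable_withDensity_iff_integrable_smul' hgm.measurable.ennreal_ofReal (by simp)] at hφ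
  simpa [IntegrableOn, ENNReal.toReal_ofReal, hg0] using hφ

lemma integral_smul_comp {F : Type*} [NormedAddCommGroup F] [NormedSpace ℝ F]
    {γ g : ℝ → ℝ} (hγ : Measurable γ) (hgm : StronglyMeasurable g) (hg0 : ∀ x, 0 ≤ g x)
    (hgi : IntegrableOn g (Icc 0 1)) (hγg : ∀ t ∈ Icc (0:ℝ) 1, γ t = ∫ τ in (0:ℝ)..t, g τ)
    {t : ℝ} (ht : t ∈ Icc (0:ℝ) 1) {φ : ℝ → F} (hφm : StronglyMeasurable φ) :
    ∫ τ in (0:ℝ)..t, g τ • φ (γ τ) = ∫ s in (0:ℝ)..γ t, φ s := by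
  have hγ0 : 0 ≤ γ t := by
    rw [hγg t ht]
    exact intervalIntegral.integral_nonneg ht.1 fun x _ => hg0 x
  rw [intervalIntegral.integral_of_le ht.1, intervalIntegral.integral_of_le hγ0,
    ← map_withDensity_eq_restrict_s10 hγ hg0 hgi hγg ht,
    integral_map hγ.aemeasurable hφm.aestronglyMeasurable,
    integral_withDensity_eq_integral_toReal_smul hgm.measurable.ennreal_ofReal (by simp)]
  simp [ENNReal.toReal_ofReal, hg0]

lemma MemGammaBar.mem_Icc {γ : ℝ → ℝ} (hγ : MemGammaBar γ) {t : ℝ} (ht : t ∈ Icc (0:ℝ) 1) :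
    γ t ∈ Icc (0:ℝ) 1 := by
  obtain ⟨γ', g, -, -, hg0, hgi, hγg, hγγ⟩ := hγ.exists_measurable
  have h1 : (1:ℝ) ∈ Icc (0:ℝ) 1 := by simp
  obtain ⟨-, -, -, hone⟩ := hγ
  refine ⟨?_, ?_⟩
  · rw [hγγ t ht, hγg t ht]
    exact intervalIntegral.integral_nonneg ht.1 fun x _ => hg0 x
  · rw [← hone, hγγ t ht, hγγ 1 h1, hγg t ht, hγg 1 h1]
    exact monotoneOn_integral hg0 hgi ht h1 ht.2

/-- Chain rule: `c ∘ γ` is an absolutely continuous curve, and its arc length on `[0,t]` is that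
of `c` on `[0, γ t]`. -/
theorem IsACDeriv.exists_comp {d : ℕ} {c f : ℝ → E d} (hc : IsACDeriv c f) {γ : ℝ → ℝ}
    (hγ : MemGammaBar γ) :
    ∃ k : ℝ → E d, (∀ x, (∀ t ∈ Icc (0:ℝ) 1, x t = c (γ t)) → IsACDeriv x k) ∧
      ∀ t ∈ Icc (0:ℝ) 1, ∫ τ in (0:ℝ)..t, ‖k τ‖ = ∫ s in (0:ℝ)..γ t, ‖f s‖ := by
  have hmem := fun t => hγ.mem_Icc (t := t)
  obtain ⟨γ', g, hγ', hgm, hg0, hgi, hγg, hγγ⟩ := hγ.exists_measurable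
  obtain ⟨hfm, hfi, hcf⟩ := hc
  have h1 : (1:ℝ) ∈ Icc (0:ℝ) 1 := by simp
  refine ⟨fun τ => g τ • f (γ' τ), fun x hx => ⟨hgm.smul (hfm.comp_measurable hγ'), ?_, ?_⟩, ?_⟩
  · rw [integrableOn_Icc_iff_integrableOn_Ioc]
    refine integrableOn_smul_comp hγ' hgm hg0 hgi hγg h1 hfm (hfi.mono_set ?_)
    rw [← hγγ 1 h1]
    exact Ioc_subset_Icc_self.trans (Icc_subset_Icc_right (hmem 1 h1).2)
  · intro t ht
    rw [integral_smul_comp hγ' hgm hg0 hgi hγg ht hfm, hx t ht, hcf _ (hmem t ht), hγγ t ht]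
  · intro t ht
    rw [hγγ t ht, ← integral_smul_comp hγ' hgm hg0 hgi hγg ht hfm.norm]
    simp [norm_smul, abs_of_nonneg (hg0 _)]

lemma IsACDeriv.sub {d : ℕ} {x y k l : ℝ → E d} (hx : IsACDeriv x k) (hy : IsACDeriv y l) :
    IsACDeriv (x - y) (k - l) := by
  have h0 : (0:ℝ) ∈ Icc (0:ℝ) 1 := by simp
  refine ⟨hx.1.sub hy.1, hx.2.1.sub hy.2.1, fun t ht => ?_⟩
  simp only [Pi.sub_apply]
  rw [hx.2.2 t ht, hy.2.2 t ht, intervalIntegral.integral_sub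
    (intervalIntegrable_of_subset hx.2.1 h0 ht) (intervalIntegrable_of_subset hy.2.1 h0 ht)]

lemma IsACDeriv.acnorm_eq {d : ℕ} {x k : ℝ → E d} (hx : IsACDeriv x k) :
    ACnorm x = ∫ t in (0:ℝ)..1, ‖k t‖ := by
  have h : ∃ f, IsACDeriv x f := ⟨k, hx⟩
  have hs := h.choose_spec
  rw [ACnorm, dif_pos h]
  refine intervalIntegral.integral_congr_ae ?_
  have hne : ∀ᵐ t : ℝ, t ≠ 1 := by simp [ae_iff, measure_singleton]
  filter_upwards [hne, ae_eq_of_integral_eq hs.2.1 hx.2.1 fun t ht => by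
    rw [← hs.2.2 t ht, ← hx.2.2 t ht]] with t h1 ht htm
  rw [uIoc_of_le zero_le_one] at htm
  rw [ht ⟨htm.1, htm.2.lt_of_ne h1⟩]

lemma strictMonoOn_integral_norm {F : Type*} [NormedAddCommGroup F] {f : ℝ → F}
    (hfi : IntegrableOn f (Icc 0 1))
    (hf : ∀ᵐ t ∂(volume.restrict (Icc (0:ℝ) 1)), f t ≠ 0) :
    StrictMonoOn (fun s => ∫ σ in (0:ℝ)..s, ‖f σ‖) (Icc 0 1) := by
  intro a ha b hb hab
  have h0 : (0:ℝ) ∈ Icc (0:ℝ) 1 := by simp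
  have hi := intervalIntegrable_of_subset hfi.norm ha hb
  have hd := intervalIntegral.integral_interval_sub_left
    (intervalIntegrable_of_subset hfi.norm h0 hb) (intervalIntegrable_of_subset hfi.norm h0 ha)
  have hpos : 0 < ∫ σ in a..b, ‖f σ‖ := by
    rw [intervalIntegral.integral_pos_iff_support_of_nonneg_ae
      (ae_of_all _ fun x => norm_nonneg _) hi]
    refine ⟨hab, ?_⟩
    have hsub : Ioc a b ⊆ Icc 0 1 := fun x hx => ⟨ha.1.trans hx.1.le, hx.2.trans hb.2⟩
    have hae := ae_restrict_of_ae_restrict_of_subset hsub hf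
    have hle : volume (Ioc a b) ≤ volume (Function.support (fun σ => ‖f σ‖) ∩ Ioc a b) := by
      refine measure_mono_ae ?_
      filter_upwards [(ae_restrict_iff' measurableSet_Ioc).1 hae] with x hx hxm
      exact ⟨by simpa using hx hxm, hxm⟩
    refine lt_of_lt_of_le ?_ hle
    simpa using hab
  dsimp only
  linarith

/-- A measurable map intertwining the primitives of `p ≥ 0` and of `q > 0` is absolutely continuous,
with derivative `p / q ∘ γ`. -/
theorem memGammaBar_of_integral_eq {p q γ : ℝ → ℝ} (hpm : StronglyMeasurable p)
    (hqm : StronglyMeasurable q) (hp0 : ∀ x, 0 ≤ p x) (hq0 : ∀ x, 0 ≤ q x)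
    (hp : IntegrableOn p (Icc 0 1)) (hq : IntegrableOn q (Icc 0 1))
    (hqne : ∀ᵐ t ∂(volume.restrict (Icc (0:ℝ) 1)), q t ≠ 0)
    (hmono : StrictMonoOn (fun s => ∫ σ in (0:ℝ)..s, q σ) (Icc 0 1))
    (hγ : Measurable γ) (hmem : ∀ t ∈ Icc (0:ℝ) 1, γ t ∈ Icc (0:ℝ) 1)
    (heq : ∀ t ∈ Icc (0:ℝ) 1, ∫ σ in (0:ℝ)..γ t, q σ = ∫ τ in (0:ℝ)..t, p τ)
    (hone : γ 1 = 1) : MemGammaBar γ := by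
  have h1 : (1:ℝ) ∈ Icc (0:ℝ) 1 := by simp
  have hg0 : ∀ x, 0 ≤ p x * (q (γ x))⁻¹ := fun x => mul_nonneg (hp0 x) (inv_nonneg.2 (hq0 _))
  have hgm : StronglyMeasurable fun x => p x * (q (γ x))⁻¹ :=
    (hpm.measurable.mul (hqm.measurable.comp hγ).inv).stronglyMeasurable
  have key : ∀ t ∈ Icc (0:ℝ) 1,
      ∫⁻ x in Ioc 0 t, ENNReal.ofReal (p x * (q (γ x))⁻¹) = ENNReal.ofReal (γ t) := by
    intro t ht
    have hsub : Icc 0 t ⊆ Icc 0 1 := Icc_subset_Icc_right ht.2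
    have hsub' : Icc 0 (γ t) ⊆ Icc 0 1 := Icc_subset_Icc_right (hmem t ht).2
    have hmap := map_withDensity_eq_of_integral_eq (p := p) (q := q) (γ := γ) (T := t)
      (S := γ t) ht.1 hp0 hq0 (hp.mono_set hsub) (hq.mono_set hsub') hγ
      (fun s hs => ⟨(hmem s (hsub hs)).1, by
        rw [← hmono.le_iff_le (hmem s (hsub hs)) (hmem t ht)]
        rw [heq s (hsub hs), heq t ht]
        exact monotoneOn_integral hp0 hp (hsub hs) ht hs.2⟩)
      (fun s hs => heq s (hsub hs)) (hmono.mono hsub') rfl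
    have hinv : Measurable fun s => ENNReal.ofReal (q s)⁻¹ := hqm.measurable.inv.ennreal_ofReal
    have hinvγ : Measurable fun x => ENNReal.ofReal (q (γ x))⁻¹ := hinv.comp hγ
    calc ∫⁻ x in Ioc 0 t, ENNReal.ofReal (p x * (q (γ x))⁻¹)
        = ∫⁻ x, ENNReal.ofReal (q (γ x))⁻¹
            ∂((volume.restrict (Ioc 0 t)).withDensity fun x => ENNReal.ofReal (p x)) := by
          rw [lintegral_withDensity_eq_lintegral_mul _ hpm.measurable.ennreal_ofReal
            hinvγ]
          simp only [Pi.mul_apply, ENNReal.ofReal_mul (hp0 _)]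
      _ = ∫⁻ s, ENNReal.ofReal (q s)⁻¹
            ∂((volume.restrict (Ioc 0 (γ t))).withDensity fun x => ENNReal.ofReal (q x)) := by
          rw [← hmap, lintegral_map hinv hγ]
      _ = ∫⁻ _ in Ioc 0 (γ t), 1 := by
          rw [lintegral_withDensity_eq_lintegral_mul _ hqm.measurable.ennreal_ofReal hinv]
          refine lintegral_congr_ae ?_
          filter_upwards [ae_restrict_of_ae_restrict_of_subset
            (Ioc_subset_Icc_self.trans hsub') hqne] with s hs
          simp only [Pi.mul_apply]
          rw [← ENNReal.ofReal_mul (hq0 s), mul_inv_cancel₀ hs, ENNReal.ofReal_one]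
      _ = ENNReal.ofReal (γ t) := by simp
  refine ⟨fun x => p x * (q (γ x))⁻¹, ⟨hgm, ?_, fun t ht => ?_⟩, ae_of_all _ hg0, hone⟩
  · rw [integrableOn_Icc_iff_integrableOn_Ioc]
    refine ⟨hgm.aestronglyMeasurable, ?_⟩
    rw [hasFiniteIntegral_iff_ofReal (ae_of_all _ hg0), key 1 h1]
    exact ENNReal.ofReal_lt_top
  · rw [intervalIntegral.integral_of_le ht.1, integral_eq_lintegral_of_nonneg_ae
      (ae_of_all _ hg0) hgm.aestronglyMeasurable, key t ht, ENNReal.toReal_ofReal (hmem t ht).1]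

lemma norm_integral_sub_le {d : ℕ} {k l : ℝ → E d} (hk : IntegrableOn k (Icc 0 1))
    (hl : IntegrableOn l (Icc 0 1)) {t : ℝ} (ht : t ∈ Icc (0:ℝ) 1) :
    ‖(∫ τ in (0:ℝ)..t, k τ) - ∫ τ in (0:ℝ)..t, l τ‖ ≤ ∫ τ in (0:ℝ)..1, ‖(k - l) τ‖ ∧
    |(∫ τ in (0:ℝ)..t, ‖k τ‖) - ∫ τ in (0:ℝ)..t, ‖l τ‖| ≤ ∫ τ in (0:ℝ)..1, ‖(k - l) τ‖ := by
  have h0 : (0:ℝ) ∈ Icc (0:ℝ) 1 := by simp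
  have h1 : (1:ℝ) ∈ Icc (0:ℝ) 1 := by simp
  have hm := monotoneOn_integral (p := fun τ => ‖(k - l) τ‖) (fun _ => norm_nonneg _)
    (hk.sub hl).norm ht h1 ht.2
  have hkl : IntervalIntegrable (fun τ => ‖(k - l) τ‖) volume 0 t :=
    intervalIntegrable_of_subset (hk.sub hl).norm h0 ht
  constructor
  · rw [← intervalIntegral.integral_sub (intervalIntegrable_of_subset hk h0 ht)
      (intervalIntegrable_of_subset hl h0 ht)]
    exact (intervalIntegral.norm_integral_le_integral_norm ht.1).trans hm
  · rw [← intervalIntegral.integral_sub (intervalIntegrable_of_subset hk.norm h0 ht)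
      (intervalIntegrable_of_subset hl.norm h0 ht), ← Real.norm_eq_abs]
    exact (intervalIntegral.norm_integral_le_of_norm_le ht.1
      (ae_of_all _ fun τ _ => abs_norm_sub_norm_le _ _) hkl).trans hm

lemma IsACDeriv.dist_le {d : ℕ} {c f : ℝ → E d} (hc : IsACDeriv c f) {a b : ℝ}
    (ha : a ∈ Icc (0:ℝ) 1) (hb : b ∈ Icc (0:ℝ) 1) :
    ‖c a - c b‖ ≤ |(∫ σ in (0:ℝ)..a, ‖f σ‖) - ∫ σ in (0:ℝ)..b, ‖f σ‖| := by
  have h0 : (0:ℝ) ∈ Icc (0:ℝ) 1 := by simp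
  rw [hc.2.2 a ha, hc.2.2 b hb, intervalIntegral.integral_interval_sub_left
    (intervalIntegrable_of_subset hc.2.1 h0 ha) (intervalIntegrable_of_subset hc.2.1 h0 hb),
    intervalIntegral.integral_interval_sub_left
    (intervalIntegrable_of_subset hc.2.1.norm h0 ha)
    (intervalIntegrable_of_subset hc.2.1.norm h0 hb)]
  exact intervalIntegral.norm_integral_le_abs_integral_norm

/-- if `c ∈ AC₀([0,1],ℝ^d)` satisfies `c' ≠ 0` a.e., then the orbit
`c ∘ Γ̄` is closed in `AC₀([0,1],ℝ^d)` with respect to the AC norm. -/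
theorem stmt_10 (d : ℕ) (c : ℝ → E d) (f : ℝ → E d) (hc : IsACDeriv c f)
    (hf : ∀ᵐ t ∂(volume.restrict (Icc (0:ℝ) 1)), f t ≠ 0) :
    ACClosure (OrbitBar c) = OrbitBar c := by
  have h0 : (0:ℝ) ∈ Icc (0:ℝ) 1 := by simp
  have h1 : (1:ℝ) ∈ Icc (0:ℝ) 1 := by simp
  refine Subset.antisymm ?_ ?_
  · rintro x ⟨⟨h, hx⟩, hclose⟩
    have hψ := strictMonoOn_integral_norm hc.2.1 hf
    have hψc : ContinuousOn (fun s => ∫ σ in (0:ℝ)..s, ‖f σ‖) (Icc 0 1) := by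
      have := intervalIntegral.continuousOn_primitive_interval (μ := volume)
        (f := fun σ => ‖f σ‖) (a := 0) (b := 1)
        (by rw [uIcc_of_le zero_le_one]; exact hc.2.1.norm)
      rwa [uIcc_of_le zero_le_one] at this
    have happrox : ∀ ε > (0:ℝ), ∃ γ, MemGammaBar γ ∧ ∀ t ∈ Icc (0:ℝ) 1,
        ‖x t - c (γ t)‖ ≤ ε ∧
        |(∫ τ in (0:ℝ)..t, ‖h τ‖) - ∫ σ in (0:ℝ)..γ t, ‖f σ‖| ≤ ε := by
      intro ε hε
      obtain ⟨y, ⟨γ, hγ, hy⟩, hlt⟩ := hclose ε hε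
      obtain ⟨k, hk, hlen⟩ := hc.exists_comp hγ
      have hyk := hk y hy
      rw [(hx.sub hyk).acnorm_eq] at hlt
      refine ⟨γ, hγ, fun t ht => ?_⟩
      have := norm_integral_sub_le hx.2.1 hyk.2.1 ht
      rw [← hx.2.2 t ht, ← hyk.2.2 t ht, hy t ht, hlen t ht] at this
      exact ⟨this.1.trans hlt.le, this.2.trans hlt.le⟩
    have hℓ1 : ∫ τ in (0:ℝ)..1, ‖h τ‖ = ∫ σ in (0:ℝ)..1, ‖f σ‖ := by
      refine eq_of_forall_dist_le fun ε hε => ?_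
      obtain ⟨γ, hγ, happ⟩ := happrox ε hε
      have := (happ 1 h1).2
      obtain ⟨-, -, -, hone⟩ := hγ
      rwa [hone] at this
    have hℓ := monotoneOn_integral (p := fun τ => ‖h τ‖) (fun _ => norm_nonneg _) hx.2.1.norm
    have hex : ∀ t : ℝ, ∃ s ∈ Icc (0:ℝ) 1, ∫ σ in (0:ℝ)..s, ‖f σ‖
        = ∫ τ in (0:ℝ)..projIcc (0:ℝ) 1 zero_le_one t, ‖h τ‖ := by
      intro t
      have hp := (projIcc (0:ℝ) 1 zero_le_one t).2
      refine intermediate_value_Icc zero_le_one hψc ⟨?_, ?_⟩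
      · simpa using intervalIntegral.integral_nonneg hp.1 fun τ _ => norm_nonneg (h τ)
      · rw [← hℓ1]
        exact hℓ hp h1 hp.2
    choose γ hγmem hγeq using hex
    have hγeq' : ∀ t ∈ Icc (0:ℝ) 1,
        ∫ σ in (0:ℝ)..γ t, ‖f σ‖ = ∫ τ in (0:ℝ)..t, ‖h τ‖ := fun t ht => by
      rw [hγeq t, projIcc_of_mem _ ht]
    have hγmono : Monotone γ := fun a b hab => by
      rw [← hψ.le_iff_le (hγmem a) (hγmem b)]
      rw [hγeq a, hγeq b]
      exact monotone_comp_projIcc hℓ hab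
    have hone : γ 1 = 1 := hψ.injOn (hγmem 1) h1 ((hγeq' 1 h1).trans hℓ1)
    refine ⟨γ, memGammaBar_of_integral_eq hx.1.norm hc.1.norm (fun _ => norm_nonneg _)
      (fun _ => norm_nonneg _) hx.2.1.norm hc.2.1.norm (by simpa using hf) hψ
      hγmono.measurable (fun t _ => hγmem t) hγeq' hone, fun t ht => ?_⟩
    refine eq_of_forall_dist_le fun ε hε => ?_
    obtain ⟨γ', hγ', happ⟩ := happrox (ε / 2) (half_pos hε)
    have hd := hc.dist_le (hγ'.mem_Icc ht) (hγmem t)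
    rw [hγeq' t ht, abs_sub_comm] at hd
    have := norm_sub_le_norm_sub_add_norm_sub (x t) (c (γ' t)) (c (γ t))
    rw [dist_eq_norm]
    linarith [(happ t ht).1, (happ t ht).2]
  · rintro x ⟨γ, hγ, hx⟩
    obtain ⟨k, hk, -⟩ := hc.exists_comp hγ
    refine ⟨⟨k, hk x hx⟩, fun ε hε => ⟨x, ⟨γ, hγ, hx⟩, ?_⟩⟩
    rw [((hk x hx).sub (hk x hx)).acnorm_eq]
    simpa using hε
end
end

section
/- For b, c ∈ AC_0([0,1],ℝ^d), the closures in AC_0 of the orbits b ∘ Γ and c ∘ Γ are either disjoint or equal. Moreover, these closures are equal if and only if b and c have the same constant speed parametrisation, i.e. there exist a ∈ AC_0([0,1],ℝ^d) with |a'| constant a.e. and β, γ ∈ Γ̄ such that b = a ∘ β and c = a ∘ γ. -/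
open MeasureTheory Set Filter
open scoped NNReal ENNReal

noncomputable section

section Primitive

variable {F : Type*} [NormedAddCommGroup F] [NormedSpace ℝ F]

/-- `c` is on `[0,1]` the primitive, vanishing at `0`, of the integrable function `f`. -/
def IsPrim (c f : ℝ → F) : Prop :=
  StronglyMeasurable f ∧ IntegrableOn f (Icc 0 1) volume ∧
    ∀ t ∈ Icc (0:ℝ) 1, c t = ∫ τ in (0:ℝ)..t, f τ

namespace IsPrim

variable {c c' f f' : ℝ → F}

lemma congr (h : IsPrim c f) (hcc : ∀ t ∈ Icc (0:ℝ) 1, c' t = c t) : IsPrim c' f :=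
  ⟨h.1, h.2.1, fun t ht => (hcc t ht).trans (h.2.2 t ht)⟩

lemma intervalIntegrable (h : IsPrim c f) {s t : ℝ} (hs : s ∈ Icc (0:ℝ) 1)
    (ht : t ∈ Icc (0:ℝ) 1) : IntervalIntegrable f volume s t :=
  (h.2.1.mono_set (uIcc_subset_Icc hs ht)).intervalIntegrable

lemma sub_eq_integral (h : IsPrim c f) {s t : ℝ} (hs : s ∈ Icc (0:ℝ) 1)
    (ht : t ∈ Icc (0:ℝ) 1) : c t - c s = ∫ τ in s..t, f τ := by
  have h0 : (0:ℝ) ∈ Icc (0:ℝ) 1 := by simp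
  rw [h.2.2 t ht, h.2.2 s hs, intervalIntegral.integral_interval_sub_left
    (h.intervalIntegrable h0 ht) (h.intervalIntegrable h0 hs)]

lemma map_zero (h : IsPrim c f) : c 0 = 0 := by
  rw [h.2.2 0 (by simp), intervalIntegral.integral_same]

lemma sub (h : IsPrim c f) (h' : IsPrim c' f') : IsPrim (c - c') (f - f') := by
  have h0 : (0:ℝ) ∈ Icc (0:ℝ) 1 := by simp
  refine ⟨h.1.sub h'.1, h.2.1.sub h'.2.1, fun t ht => ?_⟩
  simp only [Pi.sub_apply]
  rw [intervalIntegral.integral_sub (h.intervalIntegrable h0 ht) (h'.intervalIntegrable h0 ht),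
    h.2.2 t ht, h'.2.2 t ht]

lemma smul (h : IsPrim c f) (k : ℝ) : IsPrim (k • c) (k • f) := by
  refine ⟨h.1.const_smul k, h.2.1.smul k, fun t ht => ?_⟩
  simp only [Pi.smul_apply]
  rw [intervalIntegral.integral_smul, h.2.2 t ht]

lemma norm_le (h : IsPrim c f) {t : ℝ} (ht : t ∈ Icc (0:ℝ) 1) :
    ‖c t‖ ≤ ∫ τ in (0:ℝ)..1, ‖f τ‖ := by
  rw [h.2.2 t ht]
  refine (intervalIntegral.norm_integral_le_integral_norm ht.1).trans ?_
  exact intervalIntegral.integral_mono_interval le_rfl ht.1 ht.2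
    (Eventually.of_forall fun _ => norm_nonneg _)
    (h.intervalIntegrable (by simp) (by simp)).norm

lemma norm_sub_le_mul (h : IsPrim c f) {K : ℝ}
    (hK : ∀ᵐ t ∂(volume.restrict (Icc (0:ℝ) 1)), ‖f t‖ ≤ K) {s t : ℝ}
    (hs : s ∈ Icc (0:ℝ) 1) (ht : t ∈ Icc (0:ℝ) 1) : ‖c t - c s‖ ≤ K * |t - s| := by
  rw [h.sub_eq_integral hs ht]
  refine intervalIntegral.norm_integral_le_of_norm_le_const_ae ?_
  rw [ae_restrict_iff' measurableSet_Icc] at hK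
  filter_upwards [hK] with τ hτ hm
  exact hτ (uIcc_subset_Icc hs ht (uIoc_subset_uIcc hm))

lemma ae_unique [CompleteSpace F] (h : IsPrim c f) (h' : IsPrim c f') :
    f =ᵐ[volume.restrict (Icc (0:ℝ) 1)] f' := by
  have h0 : (0:ℝ) ∈ Icc (0:ℝ) 1 := by simp
  have h1 : (1:ℝ) ∈ Icc (0:ℝ) 1 := by simp
  have e : uIcc (0:ℝ) 1 = Icc 0 1 := uIcc_of_le zero_le_one
  rw [← restrict_Ioo_eq_restrict_Icc, EventuallyEq, ae_restrict_iff' measurableSet_Ioo]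
  filter_upwards [(h.intervalIntegrable h0 h1).ae_hasDerivAt_integral,
    (h'.intervalIntegrable h0 h1).ae_hasDerivAt_integral] with x hx hx' hm
  rw [e] at hx hx'
  refine (hx (Ioo_subset_Icc_self hm) 0 h0).unique
    ((hx' (Ioo_subset_Icc_self hm) 0 h0).congr_of_eventuallyEq ?_)
  filter_upwards [Ioo_mem_nhds hm.1 hm.2] with y hy
  rw [← h.2.2 y (Ioo_subset_Icc_self hy), h'.2.2 y (Ioo_subset_Icc_self hy)]

/-- Rademacher and the fundamental theorem of calculus for Lipschitz curves on `[0,1]`. -/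
lemma exists_of_lipschitz [FiniteDimensional ℝ F] {K : ℝ} (hK : 0 ≤ K) (h0 : c 0 = 0)
    (hc : ∀ s ∈ Icc (0:ℝ) 1, ∀ t ∈ Icc (0:ℝ) 1, ‖c t - c s‖ ≤ K * |t - s|) :
    ∃ f, IsPrim c f ∧ ∀ t, ‖f t‖ ≤ K := by
  have : CompleteSpace F := FiniteDimensional.complete ℝ F
  have : ProperSpace F := FiniteDimensional.proper ℝ F
  let p : ℝ → ℝ := fun t => projIcc (0:ℝ) 1 zero_le_one t
  have hp : ∀ t, p t ∈ Icc (0:ℝ) 1 := fun t => (projIcc (0:ℝ) 1 zero_le_one t).2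
  have hpid : ∀ t ∈ Icc (0:ℝ) 1, p t = t := fun t ht => by
    simp only [p, projIcc_of_mem zero_le_one ht]
  let e : ℝ → F := fun t => c (p t)
  have he : LipschitzWith ⟨K, hK⟩ e := by
    refine LipschitzWith.of_dist_le_mul fun s t => ?_
    rw [dist_eq_norm]
    refine (hc _ (hp t) _ (hp s)).trans (mul_le_mul_of_nonneg_left ?_ hK)
    exact abs_projIcc_sub_projIcc zero_le_one
  have hd : ∀ t, ‖deriv e t‖ ≤ K := fun t => norm_deriv_le_of_lipschitz he
  have hm : StronglyMeasurable (deriv e) := stronglyMeasurable_deriv e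
  have hint : ∀ s t, IntervalIntegrable (deriv e) volume s t := fun s t =>
    (intervalIntegrable_const (c := K)).mono_fun hm.aestronglyMeasurable
      (Eventually.of_forall fun x => (hd x).trans (le_abs_self K))
  refine ⟨deriv e, ⟨hm, ?_, fun t ht => ?_⟩, hd⟩
  · have := hint 0 1
    rwa [intervalIntegrable_iff_integrableOn_Icc_of_le zero_le_one] at this
  let g : ℝ → F := fun x => e x - ∫ τ in (0:ℝ)..x, deriv e τ
  have hi : LipschitzWith ⟨K, hK⟩ (fun x => ∫ τ in (0:ℝ)..x, deriv e τ) := by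
    refine LipschitzWith.of_dist_le_mul fun s t => ?_
    rw [dist_eq_norm, intervalIntegral.integral_interval_sub_left (hint _ _) (hint _ _)]
    exact intervalIntegral.norm_integral_le_of_norm_le_const fun x _ => hd x
  have hg : AbsolutelyContinuousOnInterval g 0 1 :=
    ((he.sub hi).lipschitzOnWith).absolutelyContinuousOnInterval
  obtain ⟨C, hC⟩ := hg.const_of_ae_hasDerivAt_zero (by
    filter_upwards [he.ae_differentiableAt, (hint 0 1).ae_hasDerivAt_integral] with x h1 h2 hx
    exact (h1.hasDerivAt.sub (h2 hx 0 (by simp))).congr_deriv (sub_self _))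
  have e0 : C = 0 := by
    rw [← hC 0 (by simp)]
    simp [g, e, hpid 0 (by simp), h0]
  have et := hC t (by rwa [uIcc_of_le zero_le_one])
  rw [e0] at et
  have := sub_eq_zero.1 et
  simpa only [e, hpid t ht] using this

end IsPrim

end Primitive

/-- A normalised representative of an element of `Γ̄`, with nonnegative density `g`. -/
structure IsRepar (γ g : ℝ → ℝ) : Prop where
  continuous : Continuous γ
  prim : IsPrim γ g
  nonneg : ∀ t, 0 ≤ g t
  map_one : γ 1 = 1

lemma IsPrim.isRepar {γ g : ℝ → ℝ} (h : IsPrim γ g)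
    (hg : ∀ᵐ t ∂(volume.restrict (Icc (0:ℝ) 1)), 0 ≤ g t) (h1 : γ 1 = 1) :
    ∃ γ' g', IsRepar γ' g' ∧ (∀ t ∈ Icc (0:ℝ) 1, γ' t = γ t) ∧
      g' =ᵐ[volume.restrict (Icc (0:ℝ) 1)] g := by
  have hpid : ∀ t ∈ Icc (0:ℝ) 1, (projIcc (0:ℝ) 1 zero_le_one t : ℝ) = t := fun t ht => by
    simp only [projIcc_of_mem zero_le_one ht]
  have hae : (fun t => max (g t) 0) =ᵐ[volume.restrict (Icc (0:ℝ) 1)] g := by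
    filter_upwards [hg] with t ht using max_eq_left ht
  have hgi : IntegrableOn (fun t => max (g t) 0) (Icc 0 1) volume := h.2.1.congr hae.symm
  refine ⟨fun t => γ (projIcc (0:ℝ) 1 zero_le_one t), fun t => max (g t) 0,
    ⟨?_, ⟨h.1.sup stronglyMeasurable_const, hgi, fun t ht => ?_⟩, fun t => le_max_right _ _, ?_⟩,
    fun t ht => by simp only [hpid t ht], hae⟩
  · have hc : ContinuousOn γ (Icc 0 1) :=
      (intervalIntegral.continuousOn_primitive_Icc h.2.1).congr fun t ht => by
        simp only [h.2.2 t ht, intervalIntegral.integral_of_le ht.1, integral_Icc_eq_integral_Ioc]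
    exact hc.domRestrict.comp continuous_projIcc
  · simp only [hpid t ht, h.2.2 t ht]
    refine intervalIntegral.integral_congr_ae ?_
    filter_upwards [(ae_restrict_iff' measurableSet_Icc).1 hae] with τ hτ hm
    exact (hτ (uIcc_subset_Icc (by simp) ht (uIoc_subset_uIcc hm))).symm
  · simp only [hpid 1 (by simp), h1]

lemma MemGammaBar.exists_isRepar {γ : ℝ → ℝ} (h : MemGammaBar γ) :
    ∃ γ' g, IsRepar γ' g ∧ ∀ t ∈ Icc (0:ℝ) 1, γ' t = γ t := by
  obtain ⟨g, hp, hg, h1⟩ := h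
  obtain ⟨γ', g', h, h', -⟩ := IsPrim.isRepar hp hg h1
  exact ⟨γ', g', h, h'⟩

lemma MemGamma.exists_isRepar {γ : ℝ → ℝ} (h : MemGamma γ) :
    ∃ γ' g, IsRepar γ' g ∧ (∀ᵐ t ∂(volume.restrict (Icc (0:ℝ) 1)), 0 < g t) ∧
      ∀ t ∈ Icc (0:ℝ) 1, γ' t = γ t := by
  obtain ⟨g, hp, hg, h1⟩ := h
  obtain ⟨γ', g', h, h', he⟩ := IsPrim.isRepar hp (hg.mono fun _ => le_of_lt) h1
  refine ⟨γ', g', h, ?_, h'⟩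
  filter_upwards [hg, he] with t ht ht'
  rwa [ht']

namespace IsRepar

variable {γ g : ℝ → ℝ}

lemma memGammaBar (h : IsRepar γ g) : MemGammaBar γ :=
  ⟨g, h.prim, Eventually.of_forall h.nonneg, h.map_one⟩

lemma memGamma (h : IsRepar γ g) (hg : ∀ᵐ t ∂(volume.restrict (Icc (0:ℝ) 1)), 0 < g t) :
    MemGamma γ :=
  ⟨g, h.prim, hg, h.map_one⟩

lemma map_zero (h : IsRepar γ g) : γ 0 = 0 := h.prim.map_zero

lemma monotoneOn (h : IsRepar γ g) : MonotoneOn γ (Icc 0 1) := fun s hs t ht hst => by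
  rw [← sub_nonneg, h.prim.sub_eq_integral hs ht]
  exact intervalIntegral.integral_nonneg hst fun τ _ => h.nonneg τ

lemma mem_Icc (h : IsRepar γ g) {t : ℝ} (ht : t ∈ Icc (0:ℝ) 1) : γ t ∈ Icc (0:ℝ) 1 := by
  have h0 : (0:ℝ) ∈ Icc (0:ℝ) 1 := by simp
  have h1 : (1:ℝ) ∈ Icc (0:ℝ) 1 := by simp
  exact ⟨h.map_zero ▸ h.monotoneOn h0 ht ht.1, h.map_one ▸ h.monotoneOn ht h1 ht.2⟩

lemma surjOn (h : IsRepar γ g) : SurjOn γ (Icc 0 1) (Icc 0 1) := by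
  have := intermediate_value_Icc zero_le_one h.continuous.continuousOn
  rwa [h.map_zero, h.map_one] at this

lemma integral_eq_one (h : IsRepar γ g) : ∫ t in (0:ℝ)..1, g t = 1 := by
  rw [← h.prim.2.2 1 (by simp), h.map_one]

/-- The measure with density `g` on `(0, t]`. -/
def measure (g : ℝ → ℝ) (t : ℝ) : Measure ℝ :=
  (volume.restrict (Ioc 0 t)).withDensity fun τ => (g τ).toNNReal

lemma measure_apply (h : IsRepar γ g) {S : Set ℝ} {s t : ℝ} (hs : s ∈ Icc (0:ℝ) 1)
    (hS : MeasurableSet S) (hSt : S ∩ Ioc 0 t = Ioc 0 s) :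
    measure g t S = ENNReal.ofReal (γ s) := by
  rw [measure, withDensity_apply _ hS, Measure.restrict_restrict hS, hSt, h.prim.2.2 s hs,
    intervalIntegral.integral_of_le hs.1, ofReal_integral_eq_lintegral_ofReal]
  · rfl
  · exact h.prim.2.1.mono_set (Ioc_subset_Icc_self.trans (Icc_subset_Icc_right hs.2))
  · exact Eventually.of_forall h.nonneg

lemma exists_preimage_Iic (h : IsRepar γ g) {t : ℝ} (ht : t ∈ Icc (0:ℝ) 1) (a : ℝ) :
    ∃ s ∈ Icc (0:ℝ) 1, γ ⁻¹' Iic a ∩ Ioc 0 t = Ioc 0 s ∧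
      Iic a ∩ Ioc 0 (γ t) = Ioc 0 (γ s) := by
  rcases lt_or_ge a 0 with ha | ha
  · refine ⟨0, by simp, ?_, ?_⟩
    · ext τ
      simp only [mem_inter_iff, mem_preimage, mem_Iic, mem_Ioc]
      constructor
      · rintro ⟨h1, h2, h3⟩
        have := (h.mem_Icc ⟨h2.le, h3.trans ht.2⟩).1
        linarith
      · rintro ⟨h1, h2⟩
        linarith
    · rw [h.map_zero]
      ext τ
      simp only [mem_inter_iff, mem_Iic, mem_Ioc]
      constructor
      · rintro ⟨h1, h2, h3⟩
        linarith
      · rintro ⟨h1, h2⟩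
        linarith
  rcases le_or_gt (γ t) a with hta | hta
  · refine ⟨t, ht, inter_eq_right.2 fun τ hτ => ?_, inter_eq_right.2 fun τ hτ => hτ.2.trans hta⟩
    exact (h.monotoneOn ⟨hτ.1.le, hτ.2.trans ht.2⟩ ht hτ.2).trans hta
  · have hcpt : IsCompact (Icc 0 t ∩ γ ⁻¹' Iic a) :=
      isCompact_Icc.inter_right (isClosed_Iic.preimage h.continuous)
    obtain ⟨s, ⟨hs, hsa⟩, hmax⟩ := hcpt.exists_isGreatest ⟨0, ⟨le_rfl, ht.1⟩, by
      rw [mem_preimage, h.map_zero]; exact ha⟩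
    obtain ⟨s', hs', hsa'⟩ := intermediate_value_Icc ht.1 h.continuous.continuousOn
      ⟨by rwa [h.map_zero], hta.le⟩
    have hs1 : s ∈ Icc (0:ℝ) 1 := ⟨hs.1, hs.2.trans ht.2⟩
    have hss : s' ≤ s := hmax ⟨hs', hsa'.le⟩
    have hγs : γ s = a := le_antisymm hsa
      (hsa' ▸ h.monotoneOn ⟨hs'.1, hs'.2.trans ht.2⟩ hs1 hss)
    refine ⟨s, hs1, ?_, ?_⟩
    · ext τ
      constructor
      · rintro ⟨h1, h2⟩
        exact ⟨h2.1, hmax ⟨⟨h2.1.le, h2.2⟩, h1⟩⟩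
      · intro h1
        refine ⟨?_, h1.1, h1.2.trans hs.2⟩
        exact (h.monotoneOn ⟨h1.1.le, h1.2.trans hs1.2⟩ hs1 h1.2).trans hsa
    · rw [hγs]
      ext τ
      constructor
      · rintro ⟨h1, h2⟩
        exact ⟨h2.1, h1⟩
      · rintro ⟨h1, h2⟩
        exact ⟨h2, h1, h2.trans hta.le⟩

lemma map_measure (h : IsRepar γ g) {t : ℝ} (ht : t ∈ Icc (0:ℝ) 1) :
    (measure g t).map γ = volume.restrict (Ioc 0 (γ t)) := by
  have hfin : IsFiniteMeasure (volume.restrict (Ioc 0 (γ t))) := by infer_instance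
  refine (Measure.ext_of_Iic _ _ fun a => ?_).symm
  obtain ⟨s, hs, h1, h2⟩ := h.exists_preimage_Iic ht a
  rw [Measure.map_apply h.continuous.measurable measurableSet_Iic,
    h.measure_apply hs (h.continuous.measurable measurableSet_Iic) h1,
    Measure.restrict_apply measurableSet_Iic, h2, Real.volume_Ioc, sub_zero]

lemma measurable_toNNReal (h : IsRepar γ g) : Measurable fun τ => (g τ).toNNReal :=
  h.prim.1.measurable.real_toNNReal

lemma ae_comp_iff (h : IsRepar γ g) {p : ℝ → Prop} (hp : MeasurableSet {s | p s}) :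
    (∀ᵐ s ∂(volume.restrict (Icc (0:ℝ) 1)), p s) ↔
      ∀ᵐ t ∂(volume.restrict (Icc (0:ℝ) 1)), 0 < g t → p (γ t) := by
  have hm := h.map_measure (t := 1) (by simp)
  rw [h.map_one] at hm
  rw [← restrict_Ioc_eq_restrict_Icc]
  conv_lhs => rw [← hm]
  rw [ae_map_iff h.continuous.aemeasurable hp, measure,
    ae_withDensity_iff h.measurable_toNNReal.coe_nnreal_ennreal]
  refine eventually_congr (Eventually.of_forall fun t => ?_)
  simp

lemma ae_comp (h : IsRepar γ g) {p : ℝ → Prop}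
    (hp : ∀ᵐ s ∂(volume.restrict (Icc (0:ℝ) 1)), p s) :
    ∀ᵐ t ∂(volume.restrict (Icc (0:ℝ) 1)), 0 < g t → p (γ t) := by
  obtain ⟨S, hS, hSm, hSp⟩ := hp.exists_measurable_mem
  filter_upwards [(h.ae_comp_iff (p := fun s => s ∈ S) hSm).1 hS] with t ht h0
  exact hSp _ (ht h0)

section Integral

variable {F : Type*} [NormedAddCommGroup F] [NormedSpace ℝ F] {c f : ℝ → F}

lemma integrableOn_comp (h : IsRepar γ g) (hf : IntegrableOn f (Icc 0 1)) :
    IntegrableOn (fun τ => g τ • f (γ τ)) (Icc 0 1) := by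
  have hm := h.map_measure (t := 1) (by simp)
  rw [h.map_one] at hm
  rw [IntegrableOn, ← restrict_Ioc_eq_restrict_Icc] at hf ⊢
  rw [← hm] at hf
  have := hf.comp_measurable h.continuous.measurable
  rw [measure, integrable_withDensity_iff_integrable_smul h.measurable_toNNReal] at this
  refine this.congr (Eventually.of_forall fun t => ?_)
  simp [NNReal.smul_def, h.nonneg t]

lemma integral_comp (h : IsRepar γ g) (hf : IntegrableOn f (Icc 0 1)) {t : ℝ}
    (ht : t ∈ Icc (0:ℝ) 1) :
    ∫ τ in (0:ℝ)..t, g τ • f (γ τ) = ∫ s in (0:ℝ)..γ t, f s := by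
  have hm := h.map_measure ht
  rw [intervalIntegral.integral_of_le ht.1, intervalIntegral.integral_of_le (h.mem_Icc ht).1, ← hm,
    integral_map h.continuous.aemeasurable]
  · rw [measure, integral_withDensity_eq_integral_smul h.measurable_toNNReal]
    refine integral_congr_ae (Eventually.of_forall fun t => ?_)
    simp [NNReal.smul_def, h.nonneg t]
  · rw [hm]
    exact (hf.mono_set (Ioc_subset_Icc_self.trans
      (Icc_subset_Icc_right (h.mem_Icc ht).2))).aestronglyMeasurable

lemma prim_comp (h : IsRepar γ g) (hc : IsPrim c f) :
    IsPrim (fun t => c (γ t)) (fun t => g t • f (γ t)) := by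
  refine ⟨h.prim.1.smul (hc.1.comp_measurable h.continuous.measurable),
    h.integrableOn_comp hc.2.1, fun t ht => ?_⟩
  rw [h.integral_comp hc.2.1 ht]
  exact hc.2.2 _ (h.mem_Icc ht)

end Integral

lemma comp {η k : ℝ → ℝ} (h : IsRepar γ g) (hη : IsRepar η k) :
    IsRepar (fun t => γ (η t)) (fun t => k t • g (η t)) :=
  ⟨h.continuous.comp hη.continuous, hη.prim_comp h.prim,
    fun t => mul_nonneg (hη.nonneg t) (h.nonneg _), by simp [hη.map_one, h.map_one]⟩

end IsRepar

lemma isPrim_id : IsPrim (fun t : ℝ => t) fun _ => (1 : ℝ) :=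
  ⟨stronglyMeasurable_const, integrableOn_const (by simp), fun t _ => by simp⟩

lemma isRepar_id : IsRepar (fun t => t) fun _ => 1 :=
  ⟨continuous_id, isPrim_id, fun _ => zero_le_one, rfl⟩

lemma IsPrim.norm {F : Type*} [NormedAddCommGroup F] [NormedSpace ℝ F] {c f : ℝ → F}
    (h : IsPrim c f) : IsPrim (fun t => ∫ τ in (0:ℝ)..t, ‖f τ‖) fun t => ‖f t‖ :=
  ⟨h.1.norm, h.2.1.norm, fun _ _ => rfl⟩

namespace IsRepar

variable {γ g η k : ℝ → ℝ}

/-- If a curve moves no faster than `γ`, it is a reparametrisation by `γ` of a Lipschitz curve. -/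
lemma exists_factor {F : Type*} [NormedAddCommGroup F] [NormedSpace ℝ F] [FiniteDimensional ℝ F]
    {c : ℝ → F} (h : IsRepar γ g) {K : ℝ} (hK : 0 ≤ K) (h0 : c 0 = 0)
    (hc : ∀ s ∈ Icc (0:ℝ) 1, ∀ t ∈ Icc (0:ℝ) 1, ‖c t - c s‖ ≤ K * |γ t - γ s|) :
    ∃ a f : ℝ → F, IsPrim a f ∧ (∀ t, ‖f t‖ ≤ K) ∧ (∀ t ∈ Icc (0:ℝ) 1, a (γ t) = c t) ∧
      ∀ s ∈ Icc (0:ℝ) 1, ∃ t ∈ Icc (0:ℝ) 1, γ t = s ∧ a s = c t := by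
  have hsurj : ∀ s ∈ Icc (0:ℝ) 1, ∃ t ∈ Icc (0:ℝ) 1, γ t = s := h.surjOn
  choose! σ hσ hγσ using hsurj
  have hzero : (0:ℝ) ∈ Icc (0:ℝ) 1 := by simp
  have heq : ∀ t ∈ Icc (0:ℝ) 1, c (σ (γ t)) = c t := fun t ht => by
    have := hc t ht (σ (γ t)) (hσ _ (h.mem_Icc ht))
    rw [hγσ _ (h.mem_Icc ht), sub_self, abs_zero, mul_zero] at this
    exact sub_eq_zero.1 (norm_le_zero_iff.1 this)
  obtain ⟨f, hf, hfK⟩ := IsPrim.exists_of_lipschitz (c := fun s => c (σ s)) hK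
    (by have := heq 0 hzero
        rwa [h.map_zero, h0] at this)
    (fun s hs t ht => by
      have := hc (σ s) (hσ s hs) (σ t) (hσ t ht)
      rwa [hγσ s hs, hγσ t ht] at this)
  exact ⟨_, f, hf, hfK, heq, fun s hs => ⟨σ s, hσ s hs, hγσ s hs, rfl⟩⟩

lemma exists_inverse (h : IsRepar γ g) {δ : ℝ} (hδ : 0 < δ) (hg : ∀ t, δ ≤ g t) :
    ∃ ρ r, IsRepar ρ r ∧ (∀ᵐ t ∂(volume.restrict (Icc (0:ℝ) 1)), 0 < r t) ∧
      ∀ s ∈ Icc (0:ℝ) 1, γ (ρ s) = s := by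
  have h0 : (0:ℝ) ∈ Icc (0:ℝ) 1 := by simp
  have h1 : (1:ℝ) ∈ Icc (0:ℝ) 1 := by simp
  have key : ∀ s ∈ Icc (0:ℝ) 1, ∀ t ∈ Icc (0:ℝ) 1, s ≤ t → δ * (t - s) ≤ γ t - γ s := by
    intro s hs t ht hst
    rw [h.prim.sub_eq_integral hs ht]
    have := intervalIntegral.integral_mono_on hst (intervalIntegrable_const (c := δ))
      (h.prim.intervalIntegrable hs ht) fun x _ => hg x
    rwa [intervalIntegral.integral_const, smul_eq_mul, mul_comm] at this
  have hlip : ∀ s ∈ Icc (0:ℝ) 1, ∀ t ∈ Icc (0:ℝ) 1, ‖t - s‖ ≤ δ⁻¹ * |γ t - γ s| := by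
    intro s hs t ht
    rw [← div_eq_inv_mul, le_div_iff₀ hδ, mul_comm, Real.norm_eq_abs]
    rcases le_total s t with hst | hst
    · rw [abs_of_nonneg (sub_nonneg.2 hst)]
      exact (key s hs t ht hst).trans (le_abs_self _)
    · rw [abs_sub_comm, abs_of_nonneg (sub_nonneg.2 hst), abs_sub_comm]
      exact (key t ht s hs hst).trans (le_abs_self _)
  obtain ⟨σ, r, hσ, -, hσγ, hex⟩ := h.exists_factor (c := fun t => t) (inv_nonneg.2 hδ.le) rfl hlip
  have hpos : ∀ᵐ t ∂(volume.restrict (Icc (0:ℝ) 1)), 0 < r t := by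
    rw [h.ae_comp_iff (measurableSet_lt measurable_const hσ.1.measurable)]
    filter_upwards [(h.prim_comp hσ).ae_unique (isPrim_id.congr hσγ)] with t ht hgt
    simp only [smul_eq_mul] at ht
    exact pos_of_mul_pos_right (a := g t) (by rw [ht]; exact zero_lt_one) hgt.le
  obtain ⟨ρ, r', hρ, hρσ, hr⟩ := hσ.isRepar (hpos.mono fun _ => le_of_lt)
    (by have := hσγ 1 h1; rwa [h.map_one] at this)
  refine ⟨ρ, r', hρ, ?_, fun s hs => ?_⟩
  · filter_upwards [hpos, hr] with t ht ht'
    rwa [ht']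
  · obtain ⟨t, ht, hts, hst⟩ := hex s hs
    rw [hρσ s hs, hst, hts]

lemma mix_id (h : IsRepar γ g) {δ : ℝ} (h0 : 0 ≤ δ) (h1 : δ ≤ 1) :
    IsRepar (fun t => (1 - δ) * γ t + δ * t) (fun t => (1 - δ) * g t + δ) := by
  refine ⟨by have := h.continuous; fun_prop, ⟨?_, ?_, fun t ht => ?_⟩, fun t => ?_, ?_⟩
  · exact (h.prim.1.const_mul _).add stronglyMeasurable_const
  · exact (h.prim.2.1.const_mul _).add (integrableOn_const (by simp))
  · rw [intervalIntegral.integral_add ((h.prim.intervalIntegrable (by simp) ht).const_mul _)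
      intervalIntegrable_const, intervalIntegral.integral_const_mul, ← h.prim.2.2 t ht]
    simp [mul_comm]
  · exact add_nonneg (mul_nonneg (sub_nonneg.2 h1) (h.nonneg t)) h0
  · simp [h.map_one]

lemma ae_comp_pos (hη : IsRepar η k)
    (hg : ∀ᵐ t ∂(volume.restrict (Icc (0:ℝ) 1)), 0 < g t)
    (hk : ∀ᵐ t ∂(volume.restrict (Icc (0:ℝ) 1)), 0 < k t) :
    ∀ᵐ t ∂(volume.restrict (Icc (0:ℝ) 1)), 0 < k t • g (η t) := by
  filter_upwards [hk, hη.ae_comp hg] with t h1 h2 using mul_pos h1 (h2 h1)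

/-- The right translates of `γ` by strict reparametrisations are dense in `Γ̄`. -/
lemma exists_comp_near (h : IsRepar γ g) (hη : IsRepar η k) {ε : ℝ} (hε : 0 < ε) :
    ∃ φ p, IsRepar φ p ∧ (∀ᵐ t ∂(volume.restrict (Icc (0:ℝ) 1)), 0 < p t) ∧
      ∫ t in (0:ℝ)..1, ‖p t • g (φ t) - k t‖ ≤ ε := by
  obtain ⟨δ, hδ0, hδ1, hδε⟩ : ∃ δ : ℝ, 0 < δ ∧ δ < 1 ∧ δ / (1 - δ) * 2 ≤ ε := by
    refine ⟨ε / (2 + ε), by positivity, (div_lt_one (by positivity)).2 (by linarith), ?_⟩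
    have : 1 - ε / (2 + ε) = 2 / (2 + ε) := by field_simp; ring
    rw [this]
    field_simp
    rfl
  have hδ2 : 0 < 1 - δ := sub_pos.2 hδ1
  have hγm := h.mix_id hδ0.le hδ1.le
  have hηm := hη.mix_id hδ0.le hδ1.le
  obtain ⟨ρ, r, hρ, hr, hinv⟩ := hγm.exists_inverse hδ0 fun t =>
    le_add_of_nonneg_left (mul_nonneg hδ2.le (h.nonneg t))
  have hφ := hρ.comp hηm
  set φ : ℝ → ℝ := fun t => ρ ((1 - δ) * η t + δ * t) with hφdef
  set p : ℝ → ℝ := fun t => ((1 - δ) * k t + δ) • r ((1 - δ) * η t + δ * t) with hpdef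
  refine ⟨φ, p, hφ, hηm.ae_comp_pos hr (Eventually.of_forall fun t =>
    add_pos_of_nonneg_of_pos (mul_nonneg hδ2.le (hη.nonneg t)) hδ0), ?_⟩
  have hae := (hγm.comp hφ).prim.ae_unique (hηm.prim.congr fun t ht => hinv _ (hηm.mem_Icc ht))
  have hae' : ∀ᵐ t ∂(volume.restrict (Icc (0:ℝ) 1)),
      ‖p t • g (φ t) - k t‖ ≤ δ / (1 - δ) * (p t + 1) := by
    filter_upwards [hae] with t ht
    simp only [smul_eq_mul] at ht ⊢
    have : p t * g (φ t) - k t = δ / (1 - δ) * (1 - p t) := by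
      field_simp
      linear_combination ht
    rw [this, norm_mul, Real.norm_of_nonneg (div_nonneg hδ0.le hδ2.le)]
    refine mul_le_mul_of_nonneg_left ?_ (div_nonneg hδ0.le hδ2.le)
    rw [Real.norm_eq_abs, abs_le]
    have := hφ.nonneg t
    constructor <;> linarith
  have hpi := hφ.prim.intervalIntegrable (s := 0) (t := 1) (by simp) (by simp)
  have hbi : IntervalIntegrable (fun t => δ / (1 - δ) * (p t + 1)) volume 0 1 :=
    (hpi.add intervalIntegrable_const).const_mul _
  calc ∫ t in (0:ℝ)..1, ‖p t • g (φ t) - k t‖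
      ≤ ∫ t in (0:ℝ)..1, δ / (1 - δ) * (p t + 1) :=
        intervalIntegral.integral_mono_ae_restrict zero_le_one
          (((h.comp hφ).prim.sub hη.prim).intervalIntegrable (by simp) (by simp)).norm hbi hae'
    _ = δ / (1 - δ) * 2 := by
        rw [intervalIntegral.integral_const_mul, intervalIntegral.integral_add hpi
          intervalIntegrable_const, hφ.integral_eq_one]
        norm_num
    _ ≤ ε := hδε

end IsRepar

/-- Every curve has a constant speed parametrisation. -/
lemma IsPrim.exists_constant_speed {F : Type*} [NormedAddCommGroup F] [NormedSpace ℝ F]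
    [FiniteDimensional ℝ F] {c f : ℝ → F} (h : IsPrim c f) :
    ∃ (a fa : ℝ → F) (L : ℝ) (γ g : ℝ → ℝ), IsPrim a fa ∧
      (∀ᵐ t ∂(volume.restrict (Icc (0:ℝ) 1)), ‖fa t‖ = L) ∧ IsRepar γ g ∧
      ∀ t ∈ Icc (0:ℝ) 1, c t = a (γ t) := by
  have : CompleteSpace F := FiniteDimensional.complete ℝ F
  set L := ∫ t in (0:ℝ)..1, ‖f t‖ with hL
  have hL0 : 0 ≤ L := intervalIntegral.integral_nonneg zero_le_one fun _ _ => norm_nonneg _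
  rcases hL0.eq_or_lt with hL0 | hL0
  · refine ⟨0, 0, 0, _, _, ⟨stronglyMeasurable_zero, integrableOn_zero, by simp⟩, by simp,
      isRepar_id, fun t ht => ?_⟩
    exact norm_le_zero_iff.1 ((h.norm_le ht).trans hL0.symm.le)
  obtain ⟨γ, g, hγ, hγe, hg⟩ := (h.norm.smul L⁻¹).isRepar
    (Eventually.of_forall fun t => by
      simp only [Pi.smul_apply, smul_eq_mul]
      positivity)
    (by simp only [Pi.smul_apply, smul_eq_mul]
        exact inv_mul_cancel₀ hL0.ne')
  have key : ∀ s ∈ Icc (0:ℝ) 1, ∀ t ∈ Icc (0:ℝ) 1, s ≤ t → ‖c t - c s‖ ≤ L * (γ t - γ s) := by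
    intro s hs t ht hst
    rw [hγe t ht, hγe s hs]
    simp only [Pi.smul_apply, smul_eq_mul]
    rw [← mul_sub, mul_inv_cancel_left₀ hL0.ne', h.norm.sub_eq_integral hs ht,
      h.sub_eq_integral hs ht]
    exact intervalIntegral.norm_integral_le_integral_norm hst
  obtain ⟨a, fa, ha, haL, hac, -⟩ := hγ.exists_factor hL0.le h.map_zero fun s hs t ht => by
    rcases le_total s t with hst | hst
    · exact (key s hs t ht hst).trans (mul_le_mul_of_nonneg_left (le_abs_self _) hL0.le)
    · rw [norm_sub_rev, abs_sub_comm]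
      exact (key t ht s hs hst).trans (mul_le_mul_of_nonneg_left (le_abs_self _) hL0.le)
  refine ⟨a, fa, L, γ, g, ha, ?_, hγ, fun t ht => (hac t ht).symm⟩
  rw [hγ.ae_comp_iff (measurableSet_eq_fun ha.1.norm.measurable measurable_const)]
  filter_upwards [(hγ.prim_comp ha).ae_unique (h.congr hac), hg] with t h1 h2 hpos
  simp only [Pi.smul_apply, smul_eq_mul] at h2
  have h3 : g t * ‖fa (γ t)‖ = ‖f t‖ := by
    rw [← h1, norm_smul, Real.norm_of_nonneg hpos.le]
  rw [h2] at hpos h3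
  have hf : ‖f t‖ ≠ 0 := fun h => by simp [h] at hpos
  field_simp at h3
  exact h3

/-- Composition with a curve is continuous on `Γ̄` for the AC norm. -/
lemma IsPrim.exists_comp_near {F : Type*} [NormedAddCommGroup F] [NormedSpace ℝ F]
    {a fa : ℝ → F} (ha : IsPrim a fa) {η k : ℝ → ℝ} (hη : IsRepar η k) {ε : ℝ} (hε : 0 < ε) :
    ∃ δ > 0, ∀ ψ q, IsRepar ψ q → ∫ t in (0:ℝ)..1, ‖q t - k t‖ ≤ δ →
      ∫ t in (0:ℝ)..1, ‖q t • fa (ψ t) - k t • fa (η t)‖ < ε := by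
  obtain ⟨u, husupp, huint, hucont, hui⟩ :=
    ha.2.1.exists_hasCompactSupport_integral_sub_le (ε := ε / 5) (by positivity)
  obtain ⟨M, hM⟩ := hucont.bounded_above_of_compact_support husupp
  have hM0 : 0 ≤ M := (norm_nonneg _).trans (hM 0)
  obtain ⟨δ₁, hδ₁, hu⟩ := Metric.uniformContinuous_iff.1
    (husupp.uniformContinuous_of_continuous hucont) (ε / 5) (by positivity)
  have hi0 : (0:ℝ) ∈ Icc (0:ℝ) 1 := by simp
  have hi1 : (1:ℝ) ∈ Icc (0:ℝ) 1 := by simp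
  refine ⟨min (δ₁ / 2) (ε / 5 / (M + 1)), by positivity, fun ψ q hψ hq => ?_⟩
  have hq1 : ∫ t in (0:ℝ)..1, ‖q t - k t‖ < δ₁ :=
    (hq.trans (min_le_left _ _)).trans_lt (by linarith)
  have hq2 : M * ∫ t in (0:ℝ)..1, ‖q t - k t‖ ≤ ε / 5 := by
    have := hq.trans (min_le_right _ _)
    rw [le_div_iff₀ (by positivity)] at this
    have h2 : 0 ≤ ∫ t in (0:ℝ)..1, ‖q t - k t‖ :=
      intervalIntegral.integral_nonneg zero_le_one fun _ _ => norm_nonneg _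
    linarith
  have hdist : ∀ t ∈ Icc (0:ℝ) 1, ‖u (ψ t) - u (η t)‖ ≤ ε / 5 := fun t ht => by
    rw [← dist_eq_norm]
    refine (hu ?_).le
    rw [dist_eq_norm]
    exact ((hψ.prim.sub hη.prim).norm_le ht).trans_lt hq1
  have hd : IntegrableOn (fun s => ‖fa s - u s‖) (Icc 0 1) := (ha.2.1.sub hui).norm
  have hapx : ∀ {θ l : ℝ → ℝ}, IsRepar θ l →
      IntervalIntegrable (fun t => l t * ‖fa (θ t) - u (θ t)‖) volume 0 1 ∧
      ∫ t in (0:ℝ)..1, l t * ‖fa (θ t) - u (θ t)‖ ≤ ε / 5 := fun {θ l} hθ => by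
    refine ⟨((hθ.integrableOn_comp hd).mono_set (uIcc_of_le zero_le_one).le).intervalIntegrable, ?_⟩
    have := hθ.integral_comp hd hi1
    simp only [smul_eq_mul] at this
    rw [this, hθ.map_one, intervalIntegral.integral_of_le zero_le_one,
      ← integral_Icc_eq_integral_Ioc]
    exact huint
  have hkint := hη.prim.intervalIntegrable hi0 hi1
  have hqk : IntervalIntegrable (fun t => ‖q t - k t‖) volume 0 1 :=
    ((hψ.prim.sub hη.prim).intervalIntegrable hi0 hi1).norm
  have hlhs := (((hψ.prim_comp ha).sub (hη.prim_comp ha)).intervalIntegrable hi0 hi1).norm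
  have h12 := (hapx hψ).1.add (hqk.const_mul M)
  have h123 := h12.add (hkint.const_mul (ε / 5))
  have hbound : ∀ t ∈ Icc (0:ℝ) 1, ‖q t • fa (ψ t) - k t • fa (η t)‖ ≤
      q t * ‖fa (ψ t) - u (ψ t)‖ + M * ‖q t - k t‖ + ε / 5 * k t +
        k t * ‖fa (η t) - u (η t)‖ := fun t ht => by
    have e : q t • fa (ψ t) - k t • fa (η t) = q t • (fa (ψ t) - u (ψ t)) +
        (q t - k t) • u (ψ t) + k t • (u (ψ t) - u (η t)) - k t • (fa (η t) - u (η t)) := by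
      module
    rw [e]
    refine (norm_sub_le _ _).trans (add_le_add ((norm_add₃_le).trans
      (add_le_add (add_le_add ?_ ?_) ?_)) ?_)
    · rw [norm_smul, Real.norm_of_nonneg (hψ.nonneg t)]
    · rw [norm_smul, mul_comm]
      exact mul_le_mul_of_nonneg_right (hM _) (norm_nonneg _)
    · rw [norm_smul, Real.norm_of_nonneg (hη.nonneg t), mul_comm]
      exact mul_le_mul_of_nonneg_right (hdist t ht) (hη.nonneg t)
    · rw [norm_smul, Real.norm_of_nonneg (hη.nonneg t)]
  calc ∫ t in (0:ℝ)..1, ‖q t • fa (ψ t) - k t • fa (η t)‖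
      ≤ ∫ t in (0:ℝ)..1, (q t * ‖fa (ψ t) - u (ψ t)‖ + M * ‖q t - k t‖ + ε / 5 * k t +
        k t * ‖fa (η t) - u (η t)‖) :=
        intervalIntegral.integral_mono_on zero_le_one hlhs (h123.add (hapx hη).1) hbound
    _ = (∫ t in (0:ℝ)..1, q t * ‖fa (ψ t) - u (ψ t)‖) +
        M * (∫ t in (0:ℝ)..1, ‖q t - k t‖) + ε / 5 * 1 +
        ∫ t in (0:ℝ)..1, k t * ‖fa (η t) - u (η t)‖ := by
        rw [intervalIntegral.integral_add h123 (hapx hη).1, intervalIntegral.integral_add h12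
          (hkint.const_mul _), intervalIntegral.integral_add (hapx hψ).1 (hqk.const_mul M),
          intervalIntegral.integral_const_mul, intervalIntegral.integral_const_mul,
          hη.integral_eq_one]
    _ < ε := by
        have h1 := (hapx hψ).2
        have h2 := (hapx hη).2
        linarith

lemma IsRepar.ae_norm_comp {F : Type*} [NormedAddCommGroup F] [NormedSpace ℝ F]
    {fa : ℝ → F} {γ g : ℝ → ℝ} (h : IsRepar γ g) {L : ℝ}
    (hL : ∀ᵐ t ∂(volume.restrict (Icc (0:ℝ) 1)), ‖fa t‖ = L) :
    ∀ᵐ t ∂(volume.restrict (Icc (0:ℝ) 1)), ‖g t • fa (γ t)‖ = L * g t := by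
  filter_upwards [h.ae_comp hL] with t ht
  rw [norm_smul, Real.norm_of_nonneg (h.nonneg t), mul_comm]
  rcases (h.nonneg t).eq_or_lt with h0 | h0
  · simp [← h0]
  · rw [ht h0]

lemma eq_of_forall_norm_sub_le {F : Type*} [NormedAddCommGroup F] {x y : F} {K : ℝ}
    (h : ∀ ε > 0, ‖x - y‖ ≤ K * ε) : x = y := by
  have : Tendsto (fun ε : ℝ => K * ε) (nhdsWithin 0 (Ioi 0)) (nhds 0) := by
    have : Tendsto (fun ε : ℝ => K * ε) (nhds 0) (nhds (K * 0)) :=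
      (continuous_const.mul continuous_id).tendsto 0
    rw [mul_zero] at this
    exact this.mono_left nhdsWithin_le_nhds
  have h2 := ge_of_tendsto this (b := ‖x - y‖) (by
    filter_upwards [self_mem_nhdsWithin] with ε hε using h ε hε)
  exact sub_eq_zero.1 (norm_le_zero_iff.1 h2)

/-- For `a` of constant speed, `a ∘ Γ̄` is closed in the AC norm. -/
lemma IsPrim.exists_repar_of_approx {F : Type*} [NormedAddCommGroup F] [NormedSpace ℝ F]
    {a fa x f : ℝ → F} (ha : IsPrim a fa) {L : ℝ} (hL0 : 0 ≤ L)
    (hL : ∀ᵐ t ∂(volume.restrict (Icc (0:ℝ) 1)), ‖fa t‖ = L) (hx : IsPrim x f)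
    (happ : ∀ ε > 0, ∃ ψ q, IsRepar ψ q ∧
      ∫ t in (0:ℝ)..1, ‖f t - q t • fa (ψ t)‖ < ε) :
    ∃ η k, IsRepar η k ∧ ∀ t ∈ Icc (0:ℝ) 1, x t = a (η t) := by
  have hi0 : (0:ℝ) ∈ Icc (0:ℝ) 1 := by simp
  have hi1 : (1:ℝ) ∈ Icc (0:ℝ) 1 := by simp
  have hlip : ∀ {s t : ℝ}, s ∈ Icc (0:ℝ) 1 → t ∈ Icc (0:ℝ) 1 → ‖a t - a s‖ ≤ L * |t - s| :=
    ha.norm_sub_le_mul (hL.mono fun _ => le_of_eq)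
  rcases hL0.eq_or_lt with hL0 | hL0
  · refine ⟨_, _, isRepar_id, fun t ht => eq_of_forall_norm_sub_le (K := 1) fun ε hε => ?_⟩
    obtain ⟨ψ, q, hψ, hq⟩ := happ ε hε
    have h1 := ((hx.sub (hψ.prim_comp ha)).norm_le ht).trans_lt hq
    have h2 := hlip ht (hψ.mem_Icc ht)
    rw [← hL0, zero_mul, norm_le_zero_iff, sub_eq_zero] at h2
    simp only [Pi.sub_apply, h2] at h1
    linarith
  have key : ∀ ψ q, IsRepar ψ q → ∀ t ∈ Icc (0:ℝ) 1,
      |L⁻¹ * (∫ τ in (0:ℝ)..t, ‖f τ‖) - ψ t| ≤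
        L⁻¹ * ∫ t in (0:ℝ)..1, ‖f t - q t • fa (ψ t)‖ := by
    intro ψ q hψ t ht
    have h1 := ((hx.norm.smul L⁻¹).sub hψ.prim).norm_le ht
    refine h1.trans ?_
    rw [← intervalIntegral.integral_const_mul]
    refine intervalIntegral.integral_mono_ae_restrict zero_le_one
      (((hx.norm.smul L⁻¹).sub hψ.prim).intervalIntegrable hi0 hi1).norm
      (((hx.sub (hψ.prim_comp ha)).intervalIntegrable hi0 hi1).norm.const_mul _) ?_
    filter_upwards [hψ.ae_norm_comp hL] with τ hτ
    simp only [Pi.sub_apply, Pi.smul_apply, smul_eq_mul]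
    have : L⁻¹ * ‖f τ‖ - q τ = L⁻¹ * (‖f τ‖ - ‖q τ • fa (ψ τ)‖) := by
      rw [hτ]
      field_simp
    rw [this, norm_mul, Real.norm_of_nonneg (inv_nonneg.2 hL0.le)]
    exact mul_le_mul_of_nonneg_left (abs_norm_sub_norm_le _ _) (inv_nonneg.2 hL0.le)
  obtain ⟨η, k, hη, hηe, -⟩ := (hx.norm.smul L⁻¹).isRepar
    (Eventually.of_forall fun t => by
      simp only [Pi.smul_apply, smul_eq_mul]
      positivity)
    (eq_of_forall_norm_sub_le (K := L⁻¹) fun ε hε => by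
      obtain ⟨ψ, q, hψ, hq⟩ := happ ε hε
      have := key ψ q hψ 1 hi1
      rw [hψ.map_one] at this
      exact this.trans (mul_le_mul_of_nonneg_left hq.le (inv_nonneg.2 hL0.le)))
  refine ⟨η, k, hη, fun t ht => eq_of_forall_norm_sub_le (K := 2) fun ε hε => ?_⟩
  obtain ⟨ψ, q, hψ, hq⟩ := happ ε hε
  have h1 := ((hx.sub (hψ.prim_comp ha)).norm_le ht).trans_lt hq
  have h2 := hlip (hη.mem_Icc ht) (hψ.mem_Icc ht)
  have h3 : L * |ψ t - η t| ≤ ε := by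
    have := key ψ q hψ t ht
    rw [abs_sub_comm, hηe t ht]
    simp only [Pi.smul_apply, smul_eq_mul]
    rw [← le_div_iff₀' hL0, div_eq_inv_mul]
    exact this.trans (mul_le_mul_of_nonneg_left hq.le (inv_nonneg.2 hL0.le))
  have h4 := norm_sub_le_norm_sub_add_norm_sub (x t) (a (ψ t)) (a (η t))
  simp only [Pi.sub_apply] at h1
  linarith

/-- A constant speed parametrisation is determined by any of its reparametrisations. -/
lemma IsPrim.eqOn_of_comp_eq {F : Type*} [NormedAddCommGroup F] [NormedSpace ℝ F]
    [CompleteSpace F] {a fa a' fa' : ℝ → F} {L L' : ℝ} {β g γ k : ℝ → ℝ}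
    (ha : IsPrim a fa) (ha' : IsPrim a' fa')
    (hL : ∀ᵐ t ∂(volume.restrict (Icc (0:ℝ) 1)), ‖fa t‖ = L)
    (hL' : ∀ᵐ t ∂(volume.restrict (Icc (0:ℝ) 1)), ‖fa' t‖ = L')
    (hβ : IsRepar β g) (hγ : IsRepar γ k)
    (h : ∀ t ∈ Icc (0:ℝ) 1, a (β t) = a' (γ t)) :
    ∀ t ∈ Icc (0:ℝ) 1, a t = a' t := by
  have hi1 : (1:ℝ) ∈ Icc (0:ℝ) 1 := by simp
  have hder : (fun t => L * g t) =ᵐ[volume.restrict (Icc (0:ℝ) 1)] fun t => L' * k t := by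
    filter_upwards [(hβ.prim_comp ha).ae_unique ((hγ.prim_comp ha').congr h),
      hβ.ae_norm_comp hL, hγ.ae_norm_comp hL'] with t h1 h2 h3
    rw [← h2, ← h3, h1]
  have hprim : ∀ t ∈ Icc (0:ℝ) 1, L * β t = L' * γ t := fun t ht => by
    rw [hβ.prim.2.2 t ht, hγ.prim.2.2 t ht, ← intervalIntegral.integral_const_mul,
      ← intervalIntegral.integral_const_mul]
    refine intervalIntegral.integral_congr_ae ?_
    filter_upwards [(ae_restrict_iff' measurableSet_Icc).1 hder] with τ hτ hm
    exact hτ (uIcc_subset_Icc (by simp) ht (uIoc_subset_uIcc hm))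
  have hLL : L = L' := by
    have := hprim 1 hi1
    rwa [hβ.map_one, hγ.map_one, mul_one, mul_one] at this
  subst hLL
  intro s hs
  obtain ⟨t, ht, rfl⟩ := hβ.surjOn hs
  rw [h t ht]
  have := ha'.norm_sub_le_mul (hL'.mono fun _ => le_of_eq) (hβ.mem_Icc ht) (hγ.mem_Icc ht)
  rcases eq_or_ne L 0 with h0 | h0
  · rw [h0, zero_mul, norm_le_zero_iff, sub_eq_zero] at this
    exact this
  · rw [mul_left_cancel₀ h0 (hprim t ht)]

section Closure

variable {d : ℕ}

lemma ACnorm_eq {x f : ℝ → E d} (h : IsACDeriv x f) : ACnorm x = ∫ t in (0:ℝ)..1, ‖f t‖ := by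
  have hex : ∃ f, IsACDeriv x f := ⟨f, h⟩
  rw [ACnorm, dif_pos hex]
  refine intervalIntegral.integral_congr_ae ?_
  have := IsPrim.ae_unique (show IsPrim x hex.choose from hex.choose_spec) h
  filter_upwards [(ae_restrict_iff' measurableSet_Icc).1 this] with τ hτ hm
  rw [hτ (uIcc_subset_Icc (by simp) (by simp) (uIoc_subset_uIcc hm))]

lemma mem_orbitBar_iff {a x : ℝ → E d} :
    x ∈ OrbitBar a ↔ ∃ γ g, IsRepar γ g ∧ ∀ t ∈ Icc (0:ℝ) 1, x t = a (γ t) := by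
  constructor
  · rintro ⟨γ, hγ, hx⟩
    obtain ⟨γ', g, h, he⟩ := hγ.exists_isRepar
    exact ⟨γ', g, h, fun t ht => by rw [hx t ht, he t ht]⟩
  · rintro ⟨γ, g, h, hx⟩
    exact ⟨γ, h.memGammaBar, hx⟩

lemma orbitBar_congr {a a' : ℝ → E d} (h : ∀ t ∈ Icc (0:ℝ) 1, a t = a' t) :
    OrbitBar a = OrbitBar a' := by
  ext x
  simp only [mem_orbitBar_iff]
  constructor
  · rintro ⟨γ, g, hγ, hx⟩
    exact ⟨γ, g, hγ, fun t ht => by rw [hx t ht, h _ (hγ.mem_Icc ht)]⟩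
  · rintro ⟨γ, g, hγ, hx⟩
    exact ⟨γ, g, hγ, fun t ht => by rw [hx t ht, h _ (hγ.mem_Icc ht)]⟩

/-- The AC closure of the orbit of a curve is the full `Γ̄`-orbit of its constant speed
parametrisation. -/
theorem acClosure_orbit_eq {a fa c : ℝ → E d} {L : ℝ} (ha : IsPrim a fa)
    (hL : ∀ᵐ t ∂(volume.restrict (Icc (0:ℝ) 1)), ‖fa t‖ = L) (hc : c ∈ OrbitBar a) :
    ACClosure (Orbit c) = OrbitBar a := by
  obtain ⟨γ, g, hγ, hca⟩ := mem_orbitBar_iff.1 hc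
  have hL0 : 0 ≤ L := by
    have : (ae (volume.restrict (Icc (0:ℝ) 1))).NeBot := by
      rw [ae_restrict_neBot]
      simp
    obtain ⟨t, ht⟩ := hL.exists
    exact ht ▸ norm_nonneg _
  ext x
  rw [mem_orbitBar_iff]
  constructor
  · rintro ⟨⟨f, hf⟩, happ⟩
    refine ha.exists_repar_of_approx hL0 hL hf fun ε hε => ?_
    obtain ⟨y, ⟨φ, hφ, hy⟩, hxy⟩ := happ ε hε
    obtain ⟨φ', p, hφ', -, hφe⟩ := hφ.exists_isRepar
    have hψ := hγ.comp hφ'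
    refine ⟨_, _, hψ, ?_⟩
    have hyp : IsPrim y _ := (hψ.prim_comp ha).congr fun t ht => by
      rw [hy t ht, ← hφe t ht, hca _ (hφ'.mem_Icc ht)]
    rwa [ACnorm_eq (IsPrim.sub hf hyp)] at hxy
  · rintro ⟨η, k, hη, hx⟩
    have hxp : IsPrim x _ := (hη.prim_comp ha).congr hx
    refine ⟨⟨_, hxp⟩, fun ε hε => ?_⟩
    obtain ⟨δ, hδ, hnear⟩ := ha.exists_comp_near hη hε
    obtain ⟨φ, p, hφ, hp, hφδ⟩ := hγ.exists_comp_near hη hδ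
    refine ⟨fun t => c (φ t), ⟨φ, hφ.memGamma hp, fun _ _ => rfl⟩, ?_⟩
    have hψ := hγ.comp hφ
    have hyp : IsPrim (fun t => c (φ t)) _ := (hψ.prim_comp ha).congr fun t ht =>
      hca _ (hφ.mem_Icc ht)
    rw [ACnorm_eq (hxp.sub hyp)]
    have := hnear _ _ hψ hφδ
    simpa only [Pi.sub_apply, norm_sub_rev] using this

end Closure

/-- for `b, c ∈ AC₀([0,1],ℝ^d)` the AC closures of the orbits `b ∘ Γ` and `c ∘ Γ`
are either disjoint or equal, and they are equal if and only if `b` and `c` have the same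
constant speed parametrisation, i.e. there are `a ∈ AC₀` with `|a'|` constant a.e. and
`β, γ ∈ Γ̄` with `b = a ∘ β` and `c = a ∘ γ`. -/
theorem stmt_13 (d : ℕ) (b c : ℝ → E d) (fb fc : ℝ → E d)
    (hb : IsACDeriv b fb) (hc : IsACDeriv c fc) :
    (ACClosure (Orbit b) ∩ ACClosure (Orbit c) = ∅ ∨
      ACClosure (Orbit b) = ACClosure (Orbit c)) ∧
    (ACClosure (Orbit b) = ACClosure (Orbit c) ↔
      ∃ (a : ℝ → E d) (fa : ℝ → E d) (L : ℝ), IsACDeriv a fa ∧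
        (∀ᵐ t ∂(volume.restrict (Icc (0:ℝ) 1)), ‖fa t‖ = L) ∧
        b ∈ OrbitBar a ∧ c ∈ OrbitBar a) := by
  obtain ⟨a, fa, L, β, g, ha, hL, hβ, hba⟩ :=
    IsPrim.exists_constant_speed (show IsPrim b fb from hb)
  obtain ⟨a', fa', L', γ, k, ha', hL', hγ, hca⟩ :=
    IsPrim.exists_constant_speed (show IsPrim c fc from hc)
  have hbm : b ∈ OrbitBar a := mem_orbitBar_iff.2 ⟨β, g, hβ, hba⟩
  have hcm : c ∈ OrbitBar a' := mem_orbitBar_iff.2 ⟨γ, k, hγ, hca⟩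
  have eb := acClosure_orbit_eq ha hL hbm
  have ec := acClosure_orbit_eq ha' hL' hcm
  refine ⟨?_, fun h => ?_, ?_⟩
  · rw [or_iff_not_imp_left]
    intro hne
    obtain ⟨x, hxb, hxc⟩ := nonempty_iff_ne_empty.2 hne
    rw [eb, mem_orbitBar_iff] at hxb
    rw [ec, mem_orbitBar_iff] at hxc
    obtain ⟨β', g', hβ', hx⟩ := hxb
    obtain ⟨γ', k', hγ', hx'⟩ := hxc
    rw [eb, ec]
    exact orbitBar_congr (ha.eqOn_of_comp_eq ha' hL hL' hβ' hγ' fun t ht =>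
      (hx t ht).symm.trans (hx' t ht))
  · refine ⟨a, fa, L, ha, hL, hbm, ?_⟩
    rwa [← eb, h, ec]
  · rintro ⟨a, fa, L, ha, hL, hba, hca⟩
    rw [acClosure_orbit_eq ha hL hba, acClosure_orbit_eq ha hL hca]
end
end
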